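/- arXiv:1011.3009 — 4 statements merged into one kernel-verified Lean document; each statement's English description precedes it below -/
import Mathlib

section
/- An element a of I_1 satisfies: the unital K-subalgebra of I_1 generated by a is finite-dimensional over K, if and only if a ∈ K·1 + F. In other words, K·1 + F = { a ∈ I_1 : dim_K K⟨a⟩ < ∞ }. -/
set_option linter.unusedSectionVars false

open Polynomial

noncomputable section

variable (K : Type*) [Field K] [CharZero K]

/-- Formal differentiation `∂` as a `K`-linear endomorphism of `K[x]`. -/
def derOp : Module.End K (Polynomial K) := Polynomial.derivative

/-- Multiplication by `x` as a `K`-linear endomorphism of `K[x]`. -/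
def xOp : Module.End K (Polynomial K) := LinearMap.mulLeft K (Polynomial.X : Polynomial K)

/-- Integration `∫`: the unique `K`-linear map with `∫ xⁿ = xⁿ⁺¹/(n+1)`. -/
def intOp : Module.End K (Polynomial K) :=
  Polynomial.lsum fun n => ((n : K) + 1)⁻¹ • Polynomial.monomial (n + 1)

/-- The algebra `I₁` of polynomial integro-differential operators: the unital
`K`-subalgebra of `End_K K[x]` generated by `X`, `∂` and `∫`. -/
def I1 : Subalgebra K (Module.End K (Polynomial K)) :=
  Algebra.adjoin K {xOp K, derOp K, intOp K}

/-- `H := ∂ ∘ X`. -/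
def Hop : Module.End K (Polynomial K) := derOp K * xOp K

/-- `e_{ij} := ∫^i ∂^j - ∫^{i+1} ∂^{j+1}`. -/
def eOp (i j : ℕ) : Module.End K (Polynomial K) :=
  intOp K ^ i * derOp K ^ j - intOp K ^ (i + 1) * derOp K ^ (j + 1)

/-- `F`, the `K`-linear span of the `e_{ij}`. -/
def Fspan : Submodule K (Module.End K (Polynomial K)) :=
  Submodule.span K (Set.range fun p : ℕ × ℕ => eOp K p.1 p.2)

lemma xOp_mem : xOp K ∈ I1 K := Algebra.subset_adjoin (by simp)
lemma derOp_mem : derOp K ∈ I1 K := Algebra.subset_adjoin (by simp)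
lemma intOp_mem : intOp K ∈ I1 K := Algebra.subset_adjoin (by simp)
lemma Hop_mem : Hop K ∈ I1 K := mul_mem (derOp_mem K) (xOp_mem K)
lemma eOp_mem (i j : ℕ) : eOp K i j ∈ I1 K :=
  sub_mem (mul_mem (pow_mem (intOp_mem K) i) (pow_mem (derOp_mem K) j))
    (mul_mem (pow_mem (intOp_mem K) (i + 1)) (pow_mem (derOp_mem K) (j + 1)))

/-- `H` as an element of `I₁`. -/
def HelI : I1 K := ⟨Hop K, Hop_mem K⟩
/-- `∂` as an element of `I₁`. -/
def DelI : I1 K := ⟨derOp K, derOp_mem K⟩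
/-- `∫` as an element of `I₁`. -/
def IntI : I1 K := ⟨intOp K, intOp_mem K⟩

lemma my_int_coeff (f : K[X]) (j : ℕ) :
    (intOp K f).coeff j = if j = 0 then 0 else f.coeff (j - 1) * (j : K)⁻¹ := by
  induction f using Polynomial.induction_on' with
  | add p q hp hq => rw [map_add, coeff_add, hp, hq, coeff_add]; split_ifs <;> ring
  | monomial n c =>
    have : intOp K (monomial n c) = ((n : K) + 1)⁻¹ • monomial (n + 1) c := by
      simp [intOp, lsum]
    rw [this, coeff_smul, coeff_monomial, coeff_monomial]
    rcases j with _ | j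
    · simp
    · by_cases h : n = j
      · subst h; simp [mul_comm]
      · simp [h]

lemma my_der_coeff (f : K[X]) (j : ℕ) :
    (derOp K f).coeff j = f.coeff (j + 1) * ((j : K) + 1) := by
  simp [derOp, coeff_derivative]

lemma my_x_coeff (f : K[X]) (j : ℕ) :
    (xOp K f).coeff j = if j = 0 then 0 else f.coeff (j - 1) := by
  rcases j with _ | j <;> simp [xOp]

/-- divided power basis -/
def yb (n : ℕ) : K[X] := monomial n ((n.factorial : K)⁻¹)

lemma int_yb (n : ℕ) : intOp K (yb K n) = yb K (n + 1) := by
  ext j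
  rw [my_int_coeff, yb, yb, coeff_monomial, coeff_monomial]
  rcases j with _ | j
  · simp
  · by_cases h : n = j
    · subst h; simp [Nat.factorial_succ, mul_comm]
    · simp [h]

lemma der_yb_succ (n : ℕ) : derOp K (yb K (n + 1)) = yb K n := by
  ext j
  rw [my_der_coeff, yb, yb, coeff_monomial, coeff_monomial]
  by_cases h : n = j
  · subst h
    have : (n : K) + 1 ≠ 0 := Nat.cast_add_one_ne_zero n
    have h2 : (n.factorial : K) ≠ 0 := Nat.cast_ne_zero.2 n.factorial_ne_zero
    simp [Nat.factorial_succ]; field_simp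
  · simp [h]

lemma der_yb_zero : derOp K (yb K 0) = 0 := by
  simp [derOp, yb]

lemma int_pow_yb (i n : ℕ) : (intOp K ^ i) (yb K n) = yb K (n + i) := by
  induction i with
  | zero => simp
  | succ i ih => rw [pow_succ', Module.End.mul_apply, ih, int_yb]; rfl

lemma der_pow_yb (j n : ℕ) : (derOp K ^ j) (yb K n) = if j ≤ n then yb K (n - j) else 0 := by
  induction j generalizing n with
  | zero => simp
  | succ j ih =>
    rw [pow_succ, Module.End.mul_apply]
    rcases n with _ | n
    · simp [der_yb_zero]
    · rw [der_yb_succ, ih]; simp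

lemma eOp_yb (i j n : ℕ) : eOp K i j (yb K n) = if n = j then yb K i else 0 := by
  rw [eOp, LinearMap.sub_apply, Module.End.mul_apply, Module.End.mul_apply, der_pow_yb, der_pow_yb]
  rcases lt_trichotomy n j with h | h | h
  · rw [if_neg (by omega), if_neg (by omega), if_neg (by omega)]; simp
  · subst h; simp [int_pow_yb]
  · rw [if_pos (by omega), if_pos (by omega), if_neg (by omega), int_pow_yb, int_pow_yb,
      show n - j + i = n - (j + 1) + (i + 1) by omega, sub_self]

lemma ext_yb {f g : Module.End K K[X]} (h : ∀ n, f (yb K n) = g (yb K n)) : f = g := by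
  apply Polynomial.lhom_ext'
  intro n
  ext1
  have h2 : (n.factorial : K) ≠ 0 := Nat.cast_ne_zero.2 n.factorial_ne_zero
  have : (monomial n (1 : K)) = (n.factorial : K) • yb K n := by
    rw [yb, smul_monomial]; simp [h2]
  simp only [LinearMap.comp_apply, this, map_smul, h]

lemma eOp_eq (i j : ℕ) : eOp K i j =
    ((j.factorial : K)) • LinearMap.smulRight (lcoeff K j) (yb K i) := by
  apply ext_yb
  intro n
  rw [eOp_yb]
  have h2 : (j.factorial : K) ≠ 0 := Nat.cast_ne_zero.2 j.factorial_ne_zero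
  by_cases h : n = j
  · subst h; simp [yb, coeff_monomial, smul_smul, h2]
  · simp [h, yb, coeff_monomial]

lemma smulRight_mem (j : ℕ) (g : K[X]) : LinearMap.smulRight (lcoeff K j) g ∈ Fspan K := by
  induction g using Polynomial.induction_on' with
  | add p q hp hq =>
    have : LinearMap.smulRight (lcoeff K j) (p + q) =
      LinearMap.smulRight (lcoeff K j) p + LinearMap.smulRight (lcoeff K j) q := by
      apply LinearMap.ext; intro x; simp [smul_add]
    rw [this]; exact add_mem hp hq
  | monomial n c =>
    have h2 : (j.factorial : K) ≠ 0 := Nat.cast_ne_zero.2 j.factorial_ne_zero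
    have h3 : (n.factorial : K) ≠ 0 := Nat.cast_ne_zero.2 n.factorial_ne_zero
    have : LinearMap.smulRight (lcoeff K j) (monomial n c) =
      (c * n.factorial * (j.factorial : K)⁻¹) • eOp K n j := by
      rw [eOp_eq, smul_smul]
      apply LinearMap.ext; intro x
      simp only [LinearMap.smulRight_apply, LinearMap.smul_apply, lcoeff_apply, yb, smul_monomial]
      congr 1
      simp only [smul_eq_mul]
      field_simp
    rw [this]
    exact Submodule.smul_mem _ _ (Submodule.subset_span ⟨(n, j), rfl⟩)

lemma mem_Fspan_of (f : Module.End K K[X]) (N : ℕ) (h : ∀ n, N ≤ n → f (X ^ n) = 0) :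
    f ∈ Fspan K := by
  have : f = ∑ j ∈ Finset.range N, LinearMap.smulRight (lcoeff K j) (f (X ^ j)) := by
    apply Polynomial.lhom_ext'
    intro n
    ext1
    simp only [LinearMap.comp_apply, LinearMap.sum_apply, LinearMap.smulRight_apply, lcoeff_apply,
      coeff_monomial, monomial_one_right_eq_X_pow, coeff_X_pow]
    by_cases hn : n < N
    · simp [hn]
    · rw [h n (by omega)]
      symm
      apply Finset.sum_eq_zero
      intro i hi
      rw [Finset.mem_range] at hi
      rw [if_neg (by omega), zero_smul]
  rw [this]
  exact Submodule.sum_mem _ fun j _ => smulRight_mem K j _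

lemma Fspan_range (f : Module.End K K[X]) (hf : f ∈ Fspan K) :
    ∃ N : ℕ, ∀ v, f v ∈ degreeLT K N := by
  induction hf using Submodule.span_induction with
  | mem x hx =>
    obtain ⟨⟨i, j⟩, rfl⟩ := hx
    refine ⟨i + 1, fun v => ?_⟩
    simp only [eOp_eq, LinearMap.smul_apply, LinearMap.smulRight_apply]
    apply Submodule.smul_mem
    apply Submodule.smul_mem
    rw [mem_degreeLT, yb]
    exact lt_of_le_of_lt (degree_monomial_le _ _) (by exact_mod_cast Nat.lt_succ_self i)
  | zero => exact ⟨0, fun v => by simp⟩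
  | add x y _ _ hx hy =>
    obtain ⟨N, hN⟩ := hx
    obtain ⟨M, hM⟩ := hy
    refine ⟨max N M, fun v => ?_⟩
    exact add_mem (degreeLT_mono (le_max_left _ _) (hN v)) (degreeLT_mono (le_max_right _ _) (hM v))
  | smul c x _ hx =>
    obtain ⟨N, hN⟩ := hx
    exact ⟨N, fun v => Submodule.smul_mem _ _ (hN v)⟩

lemma integral_of (lam : K) (f : Module.End K K[X]) (hf : f ∈ Fspan K) :
    IsIntegral K (algebraMap K (Module.End K K[X]) lam + f) := by
  obtain ⟨N, hN⟩ := Fspan_range K f hf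
  set a := algebraMap K (Module.End K K[X]) lam + f with ha
  have hav : ∀ v, a v = lam • v + f v := fun v => by simp [ha, Module.algebraMap_end_apply]
  have hV : ∀ v ∈ degreeLT K N, a v ∈ degreeLT K N := fun v hv => by
    rw [hav]; exact add_mem (Submodule.smul_mem _ _ hv) (hN v)
  let g : Module.End K (degreeLT K N) := a.restrict hV
  have : Module.Finite K (degreeLT K N) := Module.Finite.equiv (degreeLTEquiv K N).symm
  obtain ⟨Q, hQm, hQ⟩ : IsIntegral K g := IsIntegral.of_finite K g
  refine ⟨Q * (X - C lam), hQm.mul (monic_X_sub_C lam), ?_⟩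
  have hco : ∀ (P : K[X]) (v : degreeLT K N), ((aeval g P v : degreeLT K N) : K[X]) = aeval a P v := by
    intro P v
    induction P using Polynomial.induction_on' with
    | add p q hp hq => simp [hp, hq]
    | monomial n c =>
      simp only [aeval_monomial, Module.End.mul_apply, Module.algebraMap_end_apply]
      simp only [g, Module.End.pow_restrict n, LinearMap.restrict_apply, Submodule.coe_smul]
  rw [← aeval_def] at hQ ⊢
  rw [map_mul]
  apply LinearMap.ext
  intro v
  have h1 : aeval a (X - C lam) v = f v := by
    simp [hav, Module.algebraMap_end_apply]
  rw [Module.End.mul_apply, h1]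
  have := hco Q ⟨f v, hN v⟩
  rw [hQ] at this
  simpa using this.symm

/-- symbol representation -/
def SymRep (a : Module.End K K[X]) (N : ℕ) (D : ℕ) (p : ℤ → K[X]) : Prop :=
  (∀ k : ℤ, (D : ℤ) < |k| → p k = 0) ∧ ∀ i, N ≤ i → ∀ j : ℕ,
    (j.factorial : K) * (a (X ^ i)).coeff j = i.factorial * (p ((j : ℤ) - i)).eval (i : K)

lemma SymRep.mono {a : Module.End K K[X]} {N D N' D' : ℕ} {p : ℤ → K[X]} (h : SymRep K a N D p)
    (hN : N ≤ N') (hD : D ≤ D') : SymRep K a N' D' p :=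
  ⟨fun k hk => h.1 k (by omega), fun i hi j => h.2 i (hN.trans hi) j⟩

lemma rep_one : SymRep K 1 0 0 (Pi.single 0 1) := by
  refine ⟨fun k hk => ?_, fun i _ j => ?_⟩
  · have : k ≠ 0 := by rintro rfl; simp at hk
    simp [this]
  · by_cases h : j = i
    · subst h; simp
    · have : (j : ℤ) - i ≠ 0 := by omega
      simp [this, coeff_X_pow, h]

lemma rep_all (a : Module.End K K[X]) (ha : a ∈ I1 K) :
    ∀ b, (∃ N D p, SymRep K b N D p) → ∃ N D p, SymRep K (a * b) N D p := by
  induction ha using Algebra.adjoin_induction with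
  | mem x hx =>
    rintro b ⟨N, D, p, h1, h2⟩
    simp only [Set.mem_insert_iff, Set.mem_singleton_iff] at hx
    rcases hx with rfl | rfl | rfl
    · refine ⟨N, D + 1, fun k => (X + C (k : K)) * p (k - 1), fun k hk => ?_, fun i hi j => ?_⟩
      · beta_reduce
        rw [h1 _ (by push_cast at hk; rw [lt_abs] at hk ⊢; omega), mul_zero]
      · rw [Module.End.mul_apply, my_x_coeff]
        rcases j with _ | j
        · simp
        · have := h2 i hi j
          rw [if_neg (by omega), Nat.add_sub_cancel, Nat.factorial_succ]
          push_cast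
          rw [mul_assoc, this, show (j : ℤ) + 1 - i - 1 = j - i by ring]
          simp
          ring
    · refine ⟨N, D + 1, fun k => p (k + 1), fun k hk => ?_, fun i hi j => ?_⟩
      · exact h1 _ (by push_cast at hk; rw [lt_abs] at hk ⊢; omega)
      · beta_reduce
        rw [Module.End.mul_apply, my_der_coeff]
        have := h2 i hi (j + 1)
        rw [Nat.factorial_succ] at this
        push_cast at this
        rw [show (j : ℤ) - i + 1 = j + 1 - i by ring, ← this]
        ring
    · refine ⟨max N (D + 1), D + 1, fun k => p (k - 1), fun k hk => ?_, fun i hi j => ?_⟩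
      · exact h1 _ (by push_cast at hk; rw [lt_abs] at hk ⊢; omega)
      · beta_reduce
        rw [Module.End.mul_apply, my_int_coeff]
        rcases j with _ | j
        · rw [h1 _ (by rw [lt_abs]; right; have := le_of_max_le_right hi; omega)]; simp
        · have := h2 i (le_of_max_le_left hi) j
          rw [if_neg (by omega), Nat.add_sub_cancel, Nat.factorial_succ]
          push_cast
          have h0 : (j : K) + 1 ≠ 0 := Nat.cast_add_one_ne_zero j
          rw [show (j : ℤ) + 1 - i - 1 = j - i by ring, ← this]
          field_simp
  | algebraMap r =>
    rintro b ⟨N, D, p, h1, h2⟩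
    refine ⟨N, D, fun k => C r * p k, fun k hk => by simp [h1 k hk], fun i hi j => ?_⟩
    have := h2 i hi j
    simp only [Module.End.mul_apply, Module.algebraMap_end_apply, coeff_smul, smul_eq_mul, eval_mul,
      eval_C]
    linear_combination r * this
  | add x y _ _ hx hy =>
    intro b hb
    obtain ⟨N, D, p, h⟩ := hx b hb
    obtain ⟨M, E, q, g⟩ := hy b hb
    obtain ⟨h1, h2⟩ := h.mono K (le_max_left N M) (le_max_left D E)
    obtain ⟨g1, g2⟩ := g.mono K (le_max_right N M) (le_max_right D E)
    refine ⟨max N M, max D E, p + q, fun k hk => by simp [h1 k hk, g1 k hk], fun i hi j => ?_⟩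
    have h3 := h2 i hi j
    have g3 := g2 i hi j
    rw [add_mul, LinearMap.add_apply, coeff_add, Pi.add_apply, eval_add]
    linear_combination h3 + g3
  | mul x y _ _ hx hy =>
    intro b hb
    rw [mul_assoc]
    exact hx _ (hy _ hb)

lemma exists_rep (a : Module.End K K[X]) (ha : a ∈ I1 K) : ∃ N D p, SymRep K a N D p := by
  simpa using rep_all K a ha 1 ⟨_, _, _, rep_one K⟩

lemma coeff_apply (a : Module.End K K[X]) (f : K[X]) (j : ℕ) :
    (a f).coeff j = ∑ i ∈ f.support, f.coeff i * (a (X ^ i)).coeff j := by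
  conv_lhs => rw [f.as_sum_support_C_mul_X_pow]
  simp [← smul_eq_C_mul]

lemma top_step (a : Module.End K K[X]) (N C k : ℕ) (hk : 0 < k)
    (h1 : ∀ i j, N ≤ i → i + k < j → (a (X ^ i)).coeff j = 0)
    (h2 : ∀ i, N ≤ i → (a (X ^ i)).coeff (i + k) ≠ 0)
    (h3 : ∀ i j, i < N → C ≤ j → (a (X ^ i)).coeff j = 0)
    (f : K[X]) (d : ℕ) (hd : N ≤ d) (hdC : C ≤ d)
    (hf : f.coeff d ≠ 0) (hf' : ∀ i, d < i → f.coeff i = 0) :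
    (a f).coeff (d + k) ≠ 0 ∧ ∀ j, d + k < j → (a f).coeff j = 0 := by
  have key : ∀ i j, i ≤ d → d + k ≤ j → (i = d → d + k < j) → (a (X ^ i)).coeff j = 0 := by
    intro i j hi hj hij
    by_cases hiN : N ≤ i
    · exact h1 i j hiN (by by_cases h : i = d <;> [(have := hij h; omega); omega])
    · exact h3 i j (by omega) (by omega)
  have hs : ∀ i ∈ f.support, i ≤ d := fun i hi => by
    by_contra h
    exact (mem_support_iff.1 hi) (hf' i (by omega))
  constructor
  · rw [coeff_apply, Finset.sum_eq_single d]
    · exact mul_ne_zero hf (h2 d hd)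
    · intro i hi hne
      rw [key i _ (hs i hi) le_rfl (fun h => absurd h hne), mul_zero]
    · intro h; exact absurd (mem_support_iff.2 hf) h
  · intro j hj
    rw [coeff_apply]
    exact Finset.sum_eq_zero fun i hi => by rw [key i j (hs i hi) hj.le (fun _ => hj), mul_zero]

lemma bot_step (a : Module.End K K[X]) (N k : ℕ)
    (h1 : ∀ i j, N ≤ i → j + k < i → (a (X ^ i)).coeff j = 0)
    (h2 : ∀ i, N ≤ i + k → (a (X ^ (i + k))).coeff i ≠ 0)
    (f : K[X]) (d : ℕ) (hd : N ≤ d + k)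
    (hf : f.coeff (d + k) ≠ 0) (hf' : ∀ i, i < d + k → f.coeff i = 0) :
    (a f).coeff d ≠ 0 ∧ ∀ j, j < d → (a f).coeff j = 0 := by
  have hs : ∀ i ∈ f.support, d + k ≤ i := fun i hi => by
    by_contra h
    exact (mem_support_iff.1 hi) (hf' i (by omega))
  constructor
  · rw [coeff_apply, Finset.sum_eq_single (d + k)]
    · exact mul_ne_zero hf (h2 d hd)
    · intro i hi hne
      have := hs i hi
      rw [h1 i _ (by omega) (by omega), mul_zero]
    · intro h; exact absurd (mem_support_iff.2 hf) h
  · intro j hj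
    rw [coeff_apply]
    refine Finset.sum_eq_zero fun i hi => ?_
    have := hs i hi
    rw [h1 i j (by omega) (by omega), mul_zero]

lemma not_integral_of (a : Module.End K K[X])
    (h : ∀ M : ℕ, ∃ (f : K[X]) (j : ℕ), ((a ^ M) f).coeff j ≠ 0 ∧
      ∀ m < M, ((a ^ m) f).coeff j = 0) : ¬ IsIntegral K a := by
  rintro ⟨Q, hQ, hQa⟩
  rw [← aeval_def] at hQa
  obtain ⟨f, j, h1, h2⟩ := h Q.natDegree
  have h3 : (aeval a Q f).coeff j = 0 := by simp [hQa]
  rw [aeval_eq_sum_range, LinearMap.sum_apply, finsetSum_coeff, Finset.sum_range_succ,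
    Finset.sum_eq_zero] at h3
  · simp [hQ, h1] at h3
  · intro m hm
    simp [h2 m (Finset.mem_range.1 hm)]

lemma top_not (a : Module.End K K[X]) (N k : ℕ) (hk : 0 < k)
    (h1 : ∀ i j, N ≤ i → i + k < j → (a (X ^ i)).coeff j = 0)
    (h2 : ∀ i, N ≤ i → (a (X ^ i)).coeff (i + k) ≠ 0) : ¬ IsIntegral K a := by
  apply not_integral_of
  intro M
  obtain ⟨C, hC⟩ : ∃ C, ∀ i j, i < N → C ≤ j → (a (X ^ i)).coeff j = 0 := by
    refine ⟨(Finset.range N).sup (fun i => (a (X ^ i)).natDegree) + 1, fun i j hi hj => ?_⟩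
    apply coeff_eq_zero_of_natDegree_lt
    have := Finset.le_sup (f := fun i => (a (X ^ i)).natDegree) (Finset.mem_range.2 hi)
    omega
  have key : ∀ m, ((a ^ m) (X ^ (N + C))).coeff (N + C + m * k) ≠ 0 ∧
      ∀ j, N + C + m * k < j → ((a ^ m) (X ^ (N + C))).coeff j = 0 := by
    intro m
    induction m with
    | zero =>
      refine ⟨by simp, fun j hj => ?_⟩
      simp at hj
      simp only [pow_zero, Module.End.one_apply, coeff_X_pow]
      rw [if_neg (by omega)]
    | succ m ih =>
      rw [pow_succ', Module.End.mul_apply, show N + C + (m + 1) * k = N + C + m * k + k by ring]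
      exact top_step K a N C k hk h1 h2 hC _ _ (by omega) (by omega) ih.1 ih.2
  refine ⟨X ^ (N + C), N + C + M * k, (key M).1, fun m hm => (key m).2 _ ?_⟩
  have := Nat.mul_lt_mul_of_pos_right hm hk
  omega

lemma bot_not (a : Module.End K K[X]) (N k : ℕ) (hk : 0 < k)
    (h1 : ∀ i j, N ≤ i → j + k < i → (a (X ^ i)).coeff j = 0)
    (h2 : ∀ i, N ≤ i + k → (a (X ^ (i + k))).coeff i ≠ 0) : ¬ IsIntegral K a := by
  apply not_integral_of
  intro M
  have key : ∀ m r, m + r = M → ((a ^ m) (X ^ (N + M * k))).coeff (N + r * k) ≠ 0 ∧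
      ∀ j, j < N + r * k → ((a ^ m) (X ^ (N + M * k))).coeff j = 0 := by
    intro m
    induction m with
    | zero =>
      rintro r hr
      obtain rfl : r = M := by omega
      refine ⟨by simp, fun j hj => ?_⟩
      simp only [pow_zero, Module.End.one_apply, coeff_X_pow]
      rw [if_neg (by omega)]
    | succ m ih =>
      intro r hr
      have ih := ih (r + 1) (by omega)
      rw [show N + (r + 1) * k = N + r * k + k by ring] at ih
      rw [pow_succ', Module.End.mul_apply]
      exact bot_step K a N k h1 h2 _ _ (by omega) ih.1 ih.2
  refine ⟨X ^ (N + M * k), N, by simpa using (key M 0 (by omega)).1,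
    fun m hm => (key m (M - m) (by omega)).2 _ ?_⟩
  have : 0 < (M - m) * k := Nat.mul_pos (by omega) hk
  omega

lemma eventually_ne (q : K[X]) (hq : q ≠ 0) : ∃ N : ℕ, ∀ n : ℕ, N ≤ n → q.eval (n : K) ≠ 0 := by
  by_contra! h
  apply hq
  apply eq_zero_of_infinite_isRoot
  have hinf : Set.Infinite {n : ℕ | q.eval (n : K) = 0} := by
    rw [Set.infinite_iff_exists_gt]
    intro N
    obtain ⟨n, hn, h0⟩ := h (N + 1)
    exact ⟨n, h0, by omega⟩
  refine (hinf.image (Nat.cast_injective (R := K)).injOn).mono ?_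
  rintro _ ⟨n, hn, rfl⟩
  exact hn

lemma mem_of_integral (a : Module.End K K[X]) (ha : a ∈ I1 K) (hi : IsIntegral K a) :
    ∃ (lam : K) (f : Module.End K K[X]), f ∈ Fspan K ∧
      a = algebraMap K (Module.End K K[X]) lam + f := by
  classical
  obtain ⟨N, D, p, h1, h2⟩ := exists_rep K a ha
  have fac : ∀ n : ℕ, (n.factorial : K) ≠ 0 := fun n => Nat.cast_ne_zero.2 n.factorial_ne_zero
  have hz : ∀ i j : ℕ, N ≤ i → p ((j : ℤ) - i) = 0 → (a (X ^ i)).coeff j = 0 := by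
    intro i j hN hp
    have := h2 i hN j
    rw [hp] at this
    simpa [fac] using this
  have hnz : ∀ i j : ℕ, N ≤ i → (p ((j : ℤ) - i)).eval (i : K) ≠ 0 → (a (X ^ i)).coeff j ≠ 0 := by
    intro i j hN hp h0
    have := h2 i hN j
    rw [h0] at this
    simp [fac, hp] at this
  -- positive part
  have hpos : ∀ k : ℕ, 0 < k → p k = 0 := by
    by_contra! h
    obtain ⟨k0, hk0, hk0'⟩ := h
    have hle : ∀ k : ℕ, p k ≠ 0 → k ≤ D := fun k hk => by
      by_contra h
      exact hk (h1 _ (by rw [lt_abs]; omega))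
    let P : ℕ → Prop := fun k => p k ≠ 0
    have hP : P (Nat.findGreatest P D) := Nat.findGreatest_spec (hle _ hk0') hk0'
    have hk : 0 < Nat.findGreatest P D := lt_of_lt_of_le hk0 (Nat.le_findGreatest (hle _ hk0') hk0')
    have hgt : ∀ j : ℕ, Nat.findGreatest P D < j → p j = 0 := fun j hj => by
      by_contra h
      exact absurd (Nat.le_findGreatest (P := P) (hle _ h) h) (by omega)
    obtain ⟨N', hN'⟩ := eventually_ne K _ hP
    generalize Nat.findGreatest P D = k at *
    refine top_not K a (max N N') k hk ?_ ?_ hi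
    · intro i j hi hj
      apply hz i j (le_of_max_le_left hi)
      have := hgt (j - i) (by omega)
      rwa [Nat.cast_sub (by omega)] at this
    · intro i hi
      apply hnz i _ (le_of_max_le_left hi)
      rw [show ((i + k : ℕ) : ℤ) - i = k by push_cast; ring]
      exact hN' i (le_of_max_le_right hi)
  have hneg : ∀ k : ℕ, 0 < k → p (-k) = 0 := by
    by_contra! h
    obtain ⟨k0, hk0, hk0'⟩ := h
    have hle : ∀ k : ℕ, p (-k) ≠ 0 → k ≤ D := fun k hk => by
      by_contra h
      exact hk (h1 _ (by rw [lt_abs]; omega))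
    let P : ℕ → Prop := fun k => p (-k) ≠ 0
    have hP : P (Nat.findGreatest P D) := Nat.findGreatest_spec (hle _ hk0') hk0'
    have hk : 0 < Nat.findGreatest P D := lt_of_lt_of_le hk0 (Nat.le_findGreatest (hle _ hk0') hk0')
    have hgt : ∀ j : ℕ, Nat.findGreatest P D < j → p (-j) = 0 := fun j hj => by
      by_contra h
      exact absurd (Nat.le_findGreatest (P := P) (hle _ h) h) (by omega)
    obtain ⟨N', hN'⟩ := eventually_ne K _ hP
    generalize Nat.findGreatest P D = k at *
    refine bot_not K a (max N N') k hk ?_ ?_ hi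
    · intro i j hi hj
      apply hz i j (le_of_max_le_left hi)
      have := hgt (i - j) (by omega)
      rwa [Nat.cast_sub (by omega), neg_sub] at this
    · intro i hi
      apply hnz _ _ (le_of_max_le_left hi)
      rw [show (i : ℤ) - ((i + k : ℕ) : ℤ) = -k by push_cast; ring]
      exact hN' _ (le_of_max_le_right hi)
  have hp0 : ∀ k : ℤ, k ≠ 0 → p k = 0 := by
    intro k hk
    obtain ⟨n, rfl | rfl⟩ := k.eq_nat_or_neg
    · exact hpos n (by omega)
    · exact hneg n (by omega)
  have heig : ∀ i, N ≤ i → a (X ^ i) = (p 0).eval (i : K) • (X ^ i : K[X]) := by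
    intro i hi
    ext j
    rw [coeff_smul, coeff_X_pow]
    by_cases hj : j = i
    · subst hj
      have := h2 j hi j
      rw [sub_self] at this
      simpa using mul_left_cancel₀ (fac j) this
    · rw [hz i j hi (hp0 _ (by omega))]; simp [hj]
  obtain ⟨Q, hQ, hQa⟩ := hi
  rw [← aeval_def] at hQa
  have hroot : ∀ i : ℕ, N ≤ i → (Q.comp (p 0)).eval (i : K) = 0 := by
    intro i hi
    have hev : a.HasEigenvector ((p 0).eval (i : K)) (X ^ i : K[X]) :=
      ⟨Module.End.mem_eigenspace_iff.2 (heig i hi), pow_ne_zero _ X_ne_zero⟩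
    have := Module.End.aeval_apply_of_hasEigenvector (p := Q) hev
    rw [hQa, LinearMap.zero_apply, eq_comm, smul_eq_zero] at this
    rw [eval_comp]
    exact this.resolve_right hev.2
  have hcomp : Q.comp (p 0) = 0 := by
    by_contra h
    obtain ⟨N', hN'⟩ := eventually_ne K _ h
    exact hN' (max N N') (le_max_right _ _) (hroot _ (le_max_left _ _))
  obtain ⟨lam, hlam⟩ : ∃ lam, p 0 = C lam := by
    rcases comp_eq_zero_iff.1 hcomp with h | h
    · exact absurd h hQ.ne_zero
    · exact ⟨_, h.2⟩
  refine ⟨lam, a - algebraMap K _ lam, mem_Fspan_of K _ N fun n hn => ?_, by abel⟩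
  rw [LinearMap.sub_apply, heig n hn, hlam, Module.algebraMap_end_apply, eval_C, sub_self]


lemma gen_fin {B : Type*} [Ring B] [Algebra K B] (a : B) :
    FiniteDimensional K (Algebra.adjoin K ({a} : Set B)) ↔ IsIntegral K a := by
  constructor
  · intro h
    have h1 : IsIntegral K (⟨a, Algebra.self_mem_adjoin_singleton K a⟩ :
      Algebra.adjoin K ({a} : Set B)) := IsIntegral.of_finite K _
    exact h1.map (Algebra.adjoin K ({a} : Set B)).val
  · intro h
    exact Algebra.finite_adjoin_simple_of_isIntegral h

lemma gen_sub {B : Type*} [Ring B] [Algebra K B] (S : Subalgebra K B) (a : S) :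
    FiniteDimensional K (Algebra.adjoin K ({a} : Set S)) ↔ IsIntegral K (a : B) :=
  (gen_fin K a).trans (isIntegral_algHom_iff S.val Subtype.val_injective).symm

set_option synthInstance.maxHeartbeats 1000000
set_option maxHeartbeats 1000000

/-- For an element `a ∈ I₁`, the unital `K`-subalgebra of `I₁` generated
by `a` is finite-dimensional over `K` if and only if `a ∈ K·1 + F`. -/
theorem adjoin_finiteDimensional_iff_mem_scalars_add_F (a : I1 K) :
    letI : Ring (Algebra.adjoin K ({a} : Set (I1 K))) :=
      @Subalgebra.toRing K ↥(I1 K) _ _ _ _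
    (FiniteDimensional K (Algebra.adjoin K ({a} : Set (I1 K))) ↔
      ∃ (lam : K) (f : Module.End K (Polynomial K)), f ∈ Fspan K ∧
        (a : Module.End K (Polynomial K)) =
          algebraMap K (Module.End K (Polynomial K)) lam + f) := by
  refine Iff.trans (gen_sub K (I1 K) a) ⟨fun h => mem_of_integral K _ a.2 h, ?_⟩
  rintro ⟨lam, f, hf, h⟩
  rw [h]
  exact integral_of K lam f hf

end
end

section
/- For every K-algebra endomorphism σ of I_1 one has σ(F) ⊆ F, where F is the two-sided ideal of I_1 spanned by the elements e_{ij}. -/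
set_option linter.unusedSectionVars false

open Polynomial

noncomputable section

variable (K : Type*) [Field K] [CharZero K]

def wv (m : ℕ) : Polynomial K := Polynomial.monomial m ((m.factorial : K)⁻¹)

lemma fac_ne (m : ℕ) : (m.factorial : K) ≠ 0 := Nat.cast_ne_zero.2 (Nat.factorial_ne_zero m)

lemma der_wv_succ (m : ℕ) : derOp K (wv K (m+1)) = wv K m := by
  have h1 := fac_ne K m
  have h2 : (m:K) + 1 ≠ 0 := Nat.cast_add_one_ne_zero m
  simp only [derOp, wv, Polynomial.derivative_monomial]
  simp only [Nat.factorial_succ, Nat.add_sub_cancel]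
  congr 1
  push_cast
  field_simp

lemma der_wv_zero : derOp K (wv K 0) = 0 := by
  simp [derOp, wv]

lemma int_wv (m : ℕ) : intOp K (wv K m) = wv K (m+1) := by
  have h1 := fac_ne K m
  have h2 : (m:K) + 1 ≠ 0 := Nat.cast_add_one_ne_zero m
  simp only [intOp, wv, Polynomial.lsum_apply]
  rw [Polynomial.sum_monomial_index _ _ (by simp)]
  simp only [LinearMap.smul_apply, Polynomial.smul_monomial, Nat.factorial_succ]
  congr 1
  push_cast
  simp only [smul_eq_mul]
  field_simp

lemma x_wv (m : ℕ) : xOp K (wv K m) = ((m:K)+1) • wv K (m+1) := by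
  have h1 := fac_ne K m
  have h2 : (m:K) + 1 ≠ 0 := Nat.cast_add_one_ne_zero m
  simp only [xOp, wv, LinearMap.mulLeft_apply, Polynomial.X_mul_monomial,
    Polynomial.smul_monomial, Nat.factorial_succ]
  congr 1
  push_cast
  simp only [smul_eq_mul]
  field_simp

lemma poly_eq_sum (g : Polynomial K) :
    g = ∑ m ∈ g.support, (g.coeff m * m.factorial) • wv K m := by
  conv_lhs => rw [g.as_sum_support]
  refine Finset.sum_congr rfl fun m _ => ?_
  have h1 := fac_ne K m
  simp only [wv, Polynomial.smul_monomial, smul_eq_mul]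
  congr 1
  field_simp

lemma end_ext {S T : Module.End K (Polynomial K)} (h : ∀ m, S (wv K m) = T (wv K m)) : S = T := by
  refine LinearMap.ext fun g => ?_
  rw [poly_eq_sum K g]
  simp [h]

lemma int_pow_wv (i m : ℕ) : (intOp K ^ i) (wv K m) = wv K (m+i) := by
  induction i with
  | zero => simp
  | succ i ih => rw [pow_succ', Module.End.mul_apply, ih, int_wv]; rfl

lemma der_pow_wv (j m : ℕ) : (derOp K ^ j) (wv K (m+j)) = wv K m := by
  induction j with
  | zero => simp
  | succ j ih => rw [pow_succ, Module.End.mul_apply, ← add_assoc, der_wv_succ, ih]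

lemma der_pow_wv_zero (j m : ℕ) (h : m < j) : (derOp K ^ j) (wv K m) = 0 := by
  obtain ⟨c, rfl⟩ : ∃ c, j = c + 1 + m := ⟨j - m - 1, by omega⟩
  have := der_pow_wv K m 0
  rw [zero_add] at this
  rw [pow_add, Module.End.mul_apply, this, pow_succ, Module.End.mul_apply, der_wv_zero, map_zero]

lemma e_wv (i j m : ℕ) : eOp K i j (wv K m) = if m = j then wv K i else 0 := by
  simp only [eOp, LinearMap.sub_apply, Module.End.mul_apply]
  rcases lt_trichotomy m j with h | h | h
  · rw [der_pow_wv_zero K j m h, der_pow_wv_zero K (j+1) m (by omega), if_neg (by omega)]; simp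
  · subst h
    have := der_pow_wv K m 0
    rw [zero_add] at this
    rw [der_pow_wv_zero K (m+1) m (by omega), this, int_pow_wv]; simp
  · obtain ⟨c, rfl⟩ : ∃ c, m = c + (j + 1) := ⟨m - j - 1, by omega⟩
    rw [der_pow_wv, int_pow_wv, if_neg (by omega)]
    have : c + (j+1) = (c + 1) + j := by omega
    rw [this, der_pow_wv, int_pow_wv]
    have : c + 1 + i = c + (i+1) := by omega
    rw [this, sub_self]

lemma mem_F (T : Module.End K (Polynomial K)) (N : ℕ) (h : ∀ m, N ≤ m → T (wv K m) = 0) :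
    T ∈ Fspan K := by
  have : T = ∑ j ∈ Finset.range N, ∑ i ∈ (T (wv K j)).support,
      ((T (wv K j)).coeff i * i.factorial) • eOp K i j := by
    apply end_ext
    intro m
    simp only [LinearMap.sum_apply, LinearMap.smul_apply, e_wv]
    by_cases hm : m < N
    · rw [Finset.sum_eq_single m]
      · simp only [if_true]
        exact poly_eq_sum K _
      · intro b _ hb
        simp [hb.symm]
      · intro h; simp at h; omega
    · rw [h m (by omega), Finset.sum_eq_zero]
      intro j hj
      have : m ≠ j := by simp at hj; omega
      simp [this]
  rw [this]
  refine Submodule.sum_mem _ fun j _ => Submodule.sum_mem _ fun i _ => Submodule.smul_mem _ _ ?_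
  exact Submodule.subset_span ⟨(i, j), rfl⟩

def Gs : Submodule K (ℕ → Polynomial K) :=
  Submodule.span K (Set.range fun p : ℕ × Polynomial K => fun n => (p.2.eval (n:K)) • wv K (n + p.1))

lemma Gs_gen (k : ℕ) (q : Polynomial K) : (fun n : ℕ => (q.eval (n:K)) • wv K (n + k)) ∈ Gs K :=
  Submodule.subset_span ⟨(k, q), rfl⟩

lemma Gs_shift (s : ℕ) {f : ℕ → Polynomial K} (hf : f ∈ Gs K) : (fun n => f (n + s)) ∈ Gs K := by
  induction hf using Submodule.span_induction with
  | mem x hx =>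
    obtain ⟨⟨k, q⟩, rfl⟩ := hx
    convert Gs_gen K (s + k) (q.comp (Polynomial.X + Polynomial.C (s:K))) using 2 with n
    simp [add_assoc]
  | zero => exact (Gs K).zero_mem
  | add x y _ _ hx hy => exact (Gs K).add_mem hx hy
  | smul a x _ hx => exact (Gs K).smul_mem a hx

lemma Gs_mul (p : Polynomial K) {f : ℕ → Polynomial K} (hf : f ∈ Gs K) :
    (fun n : ℕ => (p.eval (n:K)) • f n) ∈ Gs K := by
  induction hf using Submodule.span_induction with
  | mem x hx =>
    obtain ⟨⟨k, q⟩, rfl⟩ := hx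
    convert Gs_gen K k (p * q) using 2 with n
    simp [mul_smul]
  | zero => convert (Gs K).zero_mem using 2; simp
  | add x y _ _ hx hy =>
    convert (Gs K).add_mem hx hy using 2
    simp
  | smul a x _ hx =>
    convert (Gs K).smul_mem a hx using 2
    simp [smul_comm a]

lemma Gs_comp {b : Module.End K (Polynomial K)} {M : ℕ}
    (hb : (fun n => b (wv K (n + M))) ∈ Gs K) {f : ℕ → Polynomial K} (hf : f ∈ Gs K) :
    (fun n => b (f (n + M))) ∈ Gs K := by
  induction hf using Submodule.span_induction with
  | mem x hx =>
    obtain ⟨⟨k, q⟩, rfl⟩ := hx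
    convert Gs_mul K (q.comp (Polynomial.X + Polynomial.C (M:K))) (Gs_shift K k hb) using 2 with n
    simp [add_right_comm]
  | zero => convert (Gs K).zero_mem using 2; simp
  | add x y _ _ hx hy =>
    convert (Gs K).add_mem hx hy using 2
    simp
  | smul a x _ hx =>
    convert (Gs K).smul_mem a hx using 2
    simp

lemma I1_Gs {a : Module.End K (Polynomial K)} (ha : a ∈ I1 K) :
    ∃ M, (fun n => a (wv K (n + M))) ∈ Gs K := by
  induction ha using Algebra.adjoin_induction with
  | mem x hx =>
    rcases hx with rfl | rfl | rfl
    · refine ⟨0, ?_⟩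
      convert Gs_gen K 1 (Polynomial.X + 1) using 2 with n
      simp [x_wv]
    · refine ⟨1, ?_⟩
      convert Gs_gen K 0 1 using 2 with n
      simp [der_wv_succ]
    · refine ⟨0, ?_⟩
      convert Gs_gen K 1 1 using 2 with n
      simp [int_wv]
  | algebraMap r =>
    refine ⟨0, ?_⟩
    convert Gs_gen K 0 (Polynomial.C r) using 2 with n
    simp [Module.algebraMap_end_apply]
  | add x y _ _ hx hy =>
    obtain ⟨M, hM⟩ := hx
    obtain ⟨M', hM'⟩ := hy
    refine ⟨M + M', ?_⟩
    convert (Gs K).add_mem (Gs_shift K M' hM) (Gs_shift K M hM') using 2 with n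
    simp [add_assoc, add_comm M']
  | mul x y _ _ hx hy =>
    obtain ⟨M, hM⟩ := hx
    obtain ⟨M', hM'⟩ := hy
    refine ⟨M + M', ?_⟩
    convert Gs_comp K hM hM' using 2 with n
    simp [add_assoc]

lemma Gs_str {f : ℕ → Polynomial K} (hf : f ∈ Gs K) :
    ∃ P : Polynomial (Polynomial K), ∀ n : ℕ, Polynomial.X ^ n ∣ f n ∧
      ∀ k, (((n + k).factorial : K)) * (f n).coeff (n + k) = (P.coeff k).eval (n : K) := by
  induction hf using Submodule.span_induction with
  | mem x hx =>
    obtain ⟨⟨k, q⟩, rfl⟩ := hx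
    refine ⟨Polynomial.monomial k q, fun n => ⟨?_, fun l => ?_⟩⟩
    · rw [Polynomial.X_pow_dvd_iff]
      intro d hd
      simp [wv, Polynomial.coeff_monomial, show ¬ n + k = d by omega]
    · have := fac_ne K (n + l)
      by_cases h : k = l
      · subst h
        simp [wv]
        field_simp
      · simp [wv, Polynomial.coeff_monomial, h]
  | zero => exact ⟨0, by simp⟩
  | add x y _ _ hx hy =>
    obtain ⟨P, hP⟩ := hx
    obtain ⟨Q, hQ⟩ := hy
    refine ⟨P + Q, fun n => ⟨dvd_add (hP n).1 (hQ n).1, fun k => ?_⟩⟩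
    simp [mul_add, (hP n).2, (hQ n).2]
  | smul a x _ hx =>
    obtain ⟨P, hP⟩ := hx
    refine ⟨Polynomial.C (Polynomial.C a) * P, fun n => ⟨?_, fun k => ?_⟩⟩
    · show _ ∣ a • x n
      rw [Polynomial.smul_eq_C_mul]
      exact (hP n).1.mul_left _
    · simp [← (hP n).2]; ring

lemma band {a : Module.End K (Polynomial K)} (ha : a ∈ I1 K) :
    ∃ M, ∀ n g, Polynomial.X ^ (n + M) ∣ g → Polynomial.X ^ n ∣ a g := by
  obtain ⟨M, hM⟩ := I1_Gs K ha
  obtain ⟨P, hP⟩ := Gs_str K hM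
  refine ⟨M, fun n g hg => ?_⟩
  rw [Polynomial.X_pow_dvd_iff] at hg
  rw [poly_eq_sum K g, map_sum]
  refine Finset.dvd_sum fun m hm => ?_
  have hm' : n + M ≤ m := by
    by_contra h
    exact (Polynomial.mem_support_iff.1 hm) (hg m (by omega))
  obtain ⟨c, rfl⟩ : ∃ c, m = c + M := ⟨m - M, by omega⟩
  rw [map_smul, Polynomial.smul_eq_C_mul]
  exact Dvd.dvd.mul_left ((pow_dvd_pow _ (by omega)).trans (hP c).1) _

lemma dich {a : Module.End K (Polynomial K)} (ha : a ∈ I1 K) :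
    ∃ N, (∀ g, Polynomial.X ^ N ∣ g → a g = 0) ∨ (∀ g, Polynomial.X ^ N ∣ g → a g = 0 → g = 0) := by
  obtain ⟨M, hM⟩ := I1_Gs K ha
  obtain ⟨P, hP⟩ := Gs_str K hM
  have key : ∀ (N : ℕ) (g : Polynomial K), Polynomial.X ^ (N + M) ∣ g → ∀ m ∈ g.support, ∃ c, N ≤ c ∧ m = c + M := by
    intro N g hg m hm
    rw [Polynomial.X_pow_dvd_iff] at hg
    have hm' : N + M ≤ m := by
      by_contra h
      exact (Polynomial.mem_support_iff.1 hm) (hg m (by omega))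
    exact ⟨m - M, by omega, by omega⟩
  by_cases h0 : P = 0
  · refine ⟨0 + M, Or.inl fun g hg => ?_⟩
    rw [poly_eq_sum K g, map_sum]
    refine Finset.sum_eq_zero fun m hm => ?_
    obtain ⟨c, -, rfl⟩ := key 0 g hg m hm
    rw [map_smul]
    have : a (wv K (c + M)) = 0 := by
      ext l
      by_cases hl : l < c
      · exact (Polynomial.X_pow_dvd_iff.1 (hP c).1) l hl
      · obtain ⟨k, rfl⟩ : ∃ k, l = c + k := ⟨l - c, by omega⟩
        have := (hP c).2 k
        simpa [h0, fac_ne K (c+k)] using this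
    rw [this, smul_zero]
  · have hq : P.leadingCoeff ≠ 0 := Polynomial.leadingCoeff_ne_zero.2 h0
    have hfin : {n : ℕ | P.leadingCoeff.eval (n:K) = 0}.Finite := by
      have := (Polynomial.finite_setOfPred_isRoot hq).preimage
        (f := fun n : ℕ => (n:K)) (Nat.cast_injective.injOn)
      exact this
    obtain ⟨N, hN⟩ := hfin.bddAbove
    refine ⟨(N + 1) + M, Or.inr fun g hg hag => ?_⟩
    by_contra hg0
    have hD : g.natDegree ∈ g.support := Polynomial.natDegree_mem_support_of_nonzero hg0
    obtain ⟨D, hDN, hDe⟩ := key _ g hg _ hD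
    have h1 : (a g).coeff (D + P.natDegree) = 0 := by rw [hag]; simp
    rw [poly_eq_sum K g, map_sum, Polynomial.finsetSum_coeff,
      Finset.sum_eq_single g.natDegree] at h1
    · rw [map_smul, Polynomial.coeff_smul, smul_eq_mul, hDe] at h1
      have h2 := (hP D).2 P.natDegree
      have h3 : g.coeff (D + M) ≠ 0 := by rw [← hDe]; exact Polynomial.mem_support_iff.1 hD
      have h4 : (a (wv K (D + M))).coeff (D + P.natDegree) = 0 := by
        simpa [h3, fac_ne K (D+M)] using h1
      simp only [h4, mul_zero] at h2
      have := hN (show D ∈ {n : ℕ | P.leadingCoeff.eval (n:K) = 0} from h2.symm)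
      omega
    · intro m hm hmD
      have hle := Polynomial.le_natDegree_of_mem_supp m hm
      obtain ⟨c, -, rfl⟩ := key _ g hg m hm
      obtain ⟨s, rfl⟩ : ∃ s, D = c + s := ⟨D - c, by omega⟩
      have h2 := (hP c).2 (s + P.natDegree)
      rw [Polynomial.coeff_eq_zero_of_natDegree_lt (show P.natDegree < s + P.natDegree by omega),
        ← add_assoc] at h2
      have h4 : (a (wv K (c + M))).coeff (c + s + P.natDegree) = 0 := by
        rw [Polynomial.eval_zero] at h2
        exact (mul_eq_zero.1 h2).resolve_left (fac_ne K _)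
      rw [map_smul, Polynomial.coeff_smul, h4, smul_zero]
    · intro h; exact absurd hD h

lemma wv_dvd {N m : ℕ} (h : N ≤ m) : (Polynomial.X ^ N : Polynomial K) ∣ wv K m := by
  rw [Polynomial.X_pow_dvd_iff]
  intro d hd
  simp [wv, Polynomial.coeff_monomial, show ¬ m = d by omega]

lemma ded_fin {a b : Module.End K (Polynomial K)} (ha : a ∈ I1 K) (hb : b ∈ I1 K) (hab : a * b = 1) :
    ∃ N, ∀ g, Polynomial.X ^ N ∣ g → (1 - b * a) g = 0 := by
  have he : (1 - b * a) ∈ I1 K := sub_mem (one_mem _) (mul_mem hb ha)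
  obtain ⟨N, h | h⟩ := dich K ha
  · exfalso
    obtain ⟨M, hM⟩ := band K hb
    have h1 := h _ (hM N (wv K (N+M)) (wv_dvd K le_rfl))
    rw [← Module.End.mul_apply, hab] at h1
    simp [wv] at h1
    exact Nat.factorial_ne_zero _ h1
  · obtain ⟨M, hM⟩ := band K he
    refine ⟨N + M, fun g hg => h _ (hM N g hg) ?_⟩
    rw [← Module.End.mul_apply, mul_sub, ← mul_assoc, hab]
    simp

/-- For every `K`-algebra endomorphism `σ` of `I₁` one has `σ(F) ⊆ F`. -/
theorem endomorphism_maps_F_into_F (σ : I1 K →ₐ[K] I1 K) (a : I1 K)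
    (ha : (a : Module.End K (Polynomial K)) ∈ Fspan K) :
    ((σ a : I1 K) : Module.End K (Polynomial K)) ∈ Fspan K := by
  have hDI : DelI K * IntI K = 1 := by
    apply Subtype.ext
    apply end_ext
    intro m
    simp [DelI, IntI, int_wv, der_wv_succ]
  have hab : ((σ (DelI K) : I1 K) : Module.End K (Polynomial K)) * (σ (IntI K) : I1 K) = 1 := by
    have := congrArg (fun x : I1 K => (x : Module.End K (Polynomial K))) (congrArg σ hDI)
    simpa using this
  obtain ⟨N, hN⟩ := ded_fin K (σ (DelI K)).2 (σ (IntI K)).2 hab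
  have main : ∀ y : Module.End K (Polynomial K), y ∈ Fspan K → ∃ hy : y ∈ I1 K,
      ((σ ⟨y, hy⟩ : I1 K) : Module.End K (Polynomial K)) ∈ Fspan K := by
    intro y hy
    induction hy using Submodule.span_induction with
    | mem x hx =>
      obtain ⟨⟨i, j⟩, rfl⟩ := hx
      refine ⟨eOp_mem K i j, ?_⟩
      have e1 : (⟨eOp K i j, eOp_mem K i j⟩ : I1 K)
          = IntI K ^ i * (1 - IntI K * DelI K) * DelI K ^ j := by
        apply Subtype.ext
        simp only [eOp, IntI, DelI, MulMemClass.coe_mul, SubmonoidClass.coe_pow,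
          AddSubgroupClass.coe_sub, OneMemClass.coe_one]
        rw [pow_succ, pow_succ' (derOp K)]
        simp only [mul_sub, sub_mul, mul_assoc, mul_one]
      obtain ⟨M, hM⟩ := band K (pow_mem (σ (DelI K)).2 j)
      apply mem_F K _ (N + M)
      intro m hm
      have h1 := hN _ (hM N _ (wv_dvd K hm))
      have e3 : σ (1 - IntI K * DelI K) + σ (IntI K) * σ (DelI K) = 1 := by
        have e4 : (1 - IntI K * DelI K) + IntI K * DelI K = 1 :=
          Subtype.ext (sub_add_cancel (1 : Module.End K (Polynomial K)) (intOp K * derOp K))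
        rw [← map_mul, ← map_add, e4, map_one]
      have e2 : ((σ (1 - IntI K * DelI K) : I1 K) : Module.End K (Polynomial K))
          = 1 - (σ (IntI K) : I1 K) * (σ (DelI K) : I1 K) :=
        eq_sub_of_add_eq (congrArg (fun x : I1 K => (x : Module.End K (Polynomial K))) e3)
      dsimp only
      rw [e1]
      simp only [map_mul σ (_ * _), map_mul σ (_ ^ _) (1 - _), map_pow, MulMemClass.coe_mul, SubmonoidClass.coe_pow]
      rw [e2, Module.End.mul_apply, Module.End.mul_apply, h1, map_zero]
    | zero => exact ⟨zero_mem _, by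
        have : (⟨0, zero_mem _⟩ : I1 K) = 0 := rfl
        rw [this, map_zero]; exact zero_mem _⟩
    | add x y _ _ hx hy =>
      obtain ⟨hx1, hx2⟩ := hx
      obtain ⟨hy1, hy2⟩ := hy
      refine ⟨add_mem hx1 hy1, ?_⟩
      have : (⟨x + y, add_mem hx1 hy1⟩ : I1 K) = ⟨x, hx1⟩ + ⟨y, hy1⟩ := rfl
      rw [this, map_add]
      exact add_mem hx2 hy2
    | smul c x _ hx =>
      obtain ⟨hx1, hx2⟩ := hx
      refine ⟨Subalgebra.smul_mem _ hx1 c, ?_⟩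
      have : (⟨c • x, Subalgebra.smul_mem _ hx1 c⟩ : I1 K) = c • ⟨x, hx1⟩ := rfl
      rw [this, map_smul]
      exact Submodule.smul_mem _ c hx2
  obtain ⟨_, h⟩ := main _ ha
  exact h

end
end

section
/- For every K-algebra endomorphism σ of I_1 there exist a nonzero scalar ν ∈ K, a positive integer n, a scalar μ ∈ K, and elements h, f, g ∈ F such that σ(H) = (1/n)·H + μ·1 + h, σ(∫) = ν·∫^n + f, and σ(∂) = ν^{-1}·∂^n + g. -/
set_option linter.unusedSectionVars false

open Polynomial

noncomputable section

variable (K : Type*) [Field K] [CharZero K]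

section helpers

variable {K}

open Filter

/-- divided powers, indexed by integers -/
def vv (K : Type*) [Field K] [CharZero K] (k : ℤ) : Polynomial K :=
  if 0 ≤ k then Polynomial.monomial k.toNat ((k.toNat.factorial : K)⁻¹) else 0

/-- coordinate functionals -/
def cf (K : Type*) [Field K] [CharZero K] (j : ℤ) : Polynomial K →ₗ[K] K :=
  if 0 ≤ j then (j.toNat.factorial : K) • Polynomial.lcoeff K j.toNat else 0

lemma vv_nat (n : ℕ) : vv K (n : ℤ) = Polynomial.monomial n ((n.factorial : K)⁻¹) := by
  simp [vv]

lemma vv_neg {k : ℤ} (h : k < 0) : vv K k = 0 := by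
  simp [vv, not_le.mpr h]

lemma cf_neg {k : ℤ} (h : k < 0) : cf K k = 0 := by
  simp [cf, not_le.mpr h]

lemma cf_nat (n : ℕ) (p : Polynomial K) : cf K (n : ℤ) p = (n.factorial : K) * p.coeff n := by
  simp [cf]

lemma cf_vv (j k : ℤ) : cf K j (vv K k) = if j = k ∧ 0 ≤ k then 1 else 0 := by
  rcases lt_or_ge j 0 with hj | hj
  · rw [cf_neg hj]
    rw [if_neg (by omega)]; rfl
  rcases lt_or_ge k 0 with hk | hk
  · rw [vv_neg hk, if_neg (by omega)]; simp
  lift j to ℕ using hj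
  lift k to ℕ using hk
  rw [cf_nat, vv_nat, Polynomial.coeff_monomial]
  have : (j.factorial : K) ≠ 0 := by exact_mod_cast j.factorial_ne_zero
  by_cases h : k = j
  · subst h; simp [this]
  · simp [h, Ne.symm h]

lemma cf_vv_ne {j k : ℤ} (h : j ≠ k) : cf K j (vv K k) = 0 := by
  rw [cf_vv, if_neg (by tauto)]

lemma cf_vv_self {k : ℤ} (h : 0 ≤ k) : cf K k (vv K k) = 1 := by
  rw [cf_vv, if_pos (by tauto)]

lemma expand (p : Polynomial K) (N : ℕ) (h : p.natDegree < N) :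
    p = ∑ k ∈ Finset.range N, cf K (k : ℤ) p • vv K (k : ℤ) := by
  conv_lhs => rw [p.as_sum_range' N h]
  refine Finset.sum_congr rfl fun k _ => ?_
  have : (k.factorial : K) ≠ 0 := by exact_mod_cast k.factorial_ne_zero
  rw [cf_nat, vv_nat, Polynomial.smul_monomial]
  congr 1
  simp only [smul_eq_mul]; field_simp

lemma ext_vv {M : Type*} [AddCommGroup M] [Module K M] {a b : Polynomial K →ₗ[K] M}
    (h : ∀ k : ℕ, a (vv K k) = b (vv K k)) : a = b := by
  refine LinearMap.ext fun p => ?_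
  rw [expand p _ (Nat.lt_succ_self _)]
  simp [h]

lemma der_vv (k : ℤ) : derOp K (vv K k) = vv K (k - 1) := by
  rcases lt_or_ge k 0 with hk | hk
  · rw [vv_neg hk, vv_neg (by omega)]; simp
  lift k to ℕ using hk
  rcases k with _ | k
  · rw [vv_neg (by simp : ((0:ℕ):ℤ) - 1 < 0), vv_nat]; simp [derOp]
  · rw [vv_nat]
    have : (((k+1 : ℕ) : ℤ) - 1) = (k : ℕ) := by push_cast; ring
    rw [this, vv_nat]
    simp only [derOp, Polynomial.derivative_monomial, Nat.add_sub_cancel]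
    congr 1
    have h1 : (k.factorial : K) ≠ 0 := by exact_mod_cast k.factorial_ne_zero
    have h2 : ((k : K) + 1) ≠ 0 := by exact_mod_cast k.succ_ne_zero
    rw [Nat.factorial_succ]; push_cast; field_simp

lemma int_vv {k : ℤ} (hk : 0 ≤ k) : intOp K (vv K k) = vv K (k + 1) := by
  lift k to ℕ using hk
  have : ((k : ℤ) + 1) = ((k + 1 : ℕ) : ℤ) := by push_cast; ring
  rw [this, vv_nat, vv_nat]
  simp only [intOp, Polynomial.lsum_apply]
  rw [Polynomial.sum_monomial_index _ _ (by simp)]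
  simp only [LinearMap.smul_apply, Polynomial.smul_monomial, smul_eq_mul]
  congr 1
  rw [Nat.factorial_succ]; push_cast; rw [mul_inv]

lemma x_vv (k : ℤ) : xOp K (vv K k) = ((k : K) + 1) • vv K (k + 1) := by
  rcases lt_or_ge k 0 with hk | hk
  · rcases eq_or_ne k (-1) with rfl | h
    · rw [vv_neg hk]; simp
    · rw [vv_neg hk, vv_neg (by omega)]; simp
  lift k to ℕ using hk
  have : ((k : ℤ) + 1) = ((k + 1 : ℕ) : ℤ) := by push_cast; ring
  rw [this, vv_nat, vv_nat]
  simp only [xOp, LinearMap.mulLeft_apply, Polynomial.X_mul_monomial, Polynomial.smul_monomial]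
  congr 1
  have h1 : (k.factorial : K) ≠ 0 := by exact_mod_cast k.factorial_ne_zero
  have h2 : ((k : K) + 1) ≠ 0 := by exact_mod_cast k.succ_ne_zero
  rw [Nat.factorial_succ]; push_cast; simp only [smul_eq_mul]; field_simp

lemma H_vv (k : ℤ) : Hop K (vv K k) = ((k : K) + 1) • vv K k := by
  rw [Hop, Module.End.mul_apply, x_vv, map_smul, der_vv]; simp

lemma der_pow_vv (n : ℕ) (k : ℤ) : (derOp K ^ n) (vv K k) = vv K (k - n) := by
  induction n generalizing k with
  | zero => simp
  | succ n ih => rw [pow_succ, Module.End.mul_apply, der_vv, ih]; congr 1; push_cast; ring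

lemma int_pow_vv (n : ℕ) {k : ℤ} (hk : 0 ≤ k) : (intOp K ^ n) (vv K k) = vv K (k + n) := by
  induction n generalizing k with
  | zero => simp
  | succ n ih =>
    rw [pow_succ, Module.End.mul_apply, int_vv hk, ih (by omega)]; congr 1; push_cast; ring

lemma e_vv (i j k : ℕ) : eOp K i j (vv K k) = if k = j then vv K i else 0 := by
  rw [eOp, LinearMap.sub_apply, Module.End.mul_apply, Module.End.mul_apply, der_pow_vv, der_pow_vv]
  rcases lt_trichotomy k j with h | h | h
  · rw [vv_neg (by omega), vv_neg (by omega), if_neg (by omega)]; simp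
  · subst h
    rw [if_pos rfl, int_pow_vv _ (by omega), vv_neg (by omega : (k:ℤ) - ((k+1 : ℕ) : ℤ) < 0)]
    simp
  · rw [int_pow_vv _ (by omega), int_pow_vv _ (by omega), if_neg (by omega), sub_eq_zero]
    congr 1; push_cast; ring

lemma mem_F_s7 {a : Module.End K (Polynomial K)} (h : ∀ᶠ k : ℤ in atTop, a (vv K k) = 0) :
    a ∈ Fspan K := by
  obtain ⟨N, hN⟩ := eventually_atTop.1 h
  have key : a = ∑ k ∈ Finset.range N.toNat,
      ∑ i ∈ Finset.range ((a (vv K k)).natDegree + 1), cf K (i : ℤ) (a (vv K k)) • eOp K i k := by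
    apply ext_vv
    intro l
    simp only [LinearMap.sum_apply, LinearMap.smul_apply, e_vv]
    by_cases hl : l < N.toNat
    · rw [Finset.sum_eq_single l]
      · simp only [if_true]
        exact expand _ _ (Nat.lt_succ_self _)
      · intro b _ hb
        simp [Ne.symm hb]
      · intro h; simp at h; omega
    · rw [hN l (by omega)]
      symm
      apply Finset.sum_eq_zero
      intro k hk
      have : l ≠ k := by simp at hk; omega
      simp [this]
  rw [key]
  exact Submodule.sum_mem _ fun k _ => Submodule.sum_mem _ fun i _ =>
    Submodule.smul_mem _ _ (Submodule.subset_span ⟨(i, k), rfl⟩)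

/-- asymptotic symbol evaluated at `k` -/
def ev (k : ℤ) : (ℤ →₀ Polynomial K) →+ Polynomial K :=
  Finsupp.liftAddHom fun i =>
    { toFun := fun q => q.eval (k : K) • vv K (k + i)
      map_zero' := by simp
      map_add' := by intro x y; simp [add_smul] }

lemma ev_apply (k : ℤ) (P : ℤ →₀ Polynomial K) :
    ev k P = ∑ i ∈ P.support, (P i).eval (k : K) • vv K (k + i) := rfl

lemma ev_single (k i : ℤ) (q : Polynomial K) :
    ev k (Finsupp.single i q) = q.eval (k : K) • vv K (k + i) := by
  simp [ev]

/-- `P` is the symbol of `a` -/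
def Symb (a : Module.End K (Polynomial K)) (P : ℤ →₀ Polynomial K) : Prop :=
  ∀ᶠ k : ℤ in atTop, a (vv K k) = ev k P

lemma Symb.mul {a b : Module.End K (Polynomial K)} {P Q : ℤ →₀ Polynomial K}
    (ha : Symb a P) (hb : Symb b Q) : ∀ᶠ k : ℤ in atTop, (a * b) (vv K k) =
      ∑ j ∈ Q.support, ∑ i ∈ P.support,
        ((Q j).eval (k : K) * (P i).eval ((k : K) + j)) • vv K (k + (i + j)) := by
  have h1 : ∀ᶠ k : ℤ in atTop, ∀ j ∈ Q.support, a (vv K (k + j)) = ev (k + j) P := by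
    rw [Filter.eventually_all_finset]
    intro j _
    exact (tendsto_atTop_add_const_right atTop j tendsto_id).eventually ha
  filter_upwards [h1, hb] with k h1 h2
  rw [Module.End.mul_apply, h2, ev_apply, map_sum]
  refine Finset.sum_congr rfl fun j hj => ?_
  rw [map_smul, h1 j hj, ev_apply, Finset.smul_sum]
  refine Finset.sum_congr rfl fun i _ => ?_
  rw [smul_smul]
  push_cast
  congr 2
  ring

lemma exists_rep_s7 {a : Module.End K (Polynomial K)} (ha : a ∈ I1 K) : ∃ P, Symb a P := by
  induction ha using Algebra.adjoin_induction with
  | mem x hx =>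
    simp only [Set.mem_insert_iff, Set.mem_singleton_iff] at hx
    rcases hx with rfl | rfl | rfl
    · refine ⟨Finsupp.single 1 (Polynomial.X + 1), Eventually.of_forall fun k => ?_⟩
      rw [x_vv, ev_single]; simp
    · refine ⟨Finsupp.single (-1) 1, Eventually.of_forall fun k => ?_⟩
      rw [der_vv, ev_single]; simp [sub_eq_add_neg]
    · refine ⟨Finsupp.single 1 1, ?_⟩
      filter_upwards [eventually_ge_atTop 0] with k hk
      rw [int_vv hk, ev_single]; simp
  | algebraMap r =>
    refine ⟨Finsupp.single 0 (Polynomial.C r), Eventually.of_forall fun k => ?_⟩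
    rw [ev_single]; simp [Algebra.algebraMap_eq_smul_one]
  | add x y _ _ hx hy =>
    obtain ⟨P, hP⟩ := hx
    obtain ⟨Q, hQ⟩ := hy
    refine ⟨P + Q, ?_⟩
    filter_upwards [hP, hQ] with k h1 h2
    rw [LinearMap.add_apply, h1, h2, map_add]
  | mul x y _ _ hx hy =>
    obtain ⟨P, hP⟩ := hx
    obtain ⟨Q, hQ⟩ := hy
    refine ⟨∑ j ∈ Q.support, ∑ i ∈ P.support,
      Finsupp.single (i + j) (Q j * (P i).comp (Polynomial.X + Polynomial.C (j : K))), ?_⟩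
    filter_upwards [hP.mul hQ] with k h
    rw [h, map_sum]
    refine Finset.sum_congr rfl fun j _ => ?_
    rw [map_sum]
    refine Finset.sum_congr rfl fun i _ => ?_
    rw [ev_single]; simp

lemma poly_zero {f : Polynomial K} (h : ∀ᶠ k : ℤ in atTop, f.eval (k : K) = 0) : f = 0 := by
  obtain ⟨N, hN⟩ := eventually_atTop.1 h
  apply Polynomial.eq_zero_of_infinite_isRoot
  refine Set.Infinite.mono (s := (fun k : ℤ => (k : K)) '' Set.Ici N) ?_ ?_
  · rintro _ ⟨k, hk, rfl⟩; exact hN k hk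
  · exact (Set.Ici_infinite N).image (Int.cast_injective.injOn)

lemma poly_eq {f g : Polynomial K} (h : ∀ᶠ k : ℤ in atTop, f.eval (k : K) = g.eval (k : K)) :
    f = g := by
  rw [← sub_eq_zero]
  apply poly_zero
  filter_upwards [h] with k hk
  simp [hk]

lemma poly_periodic {f : Polynomial K} {m : ℤ} (hm : m ≠ 0)
    (h : f.comp (Polynomial.X + Polynomial.C (m : K)) = f) : f = Polynomial.C (f.eval 0) := by
  have h1 : ∀ k : ℕ, f.eval ((m : K) * k) = f.eval 0 := by
    intro k
    induction k with
    | zero => simp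
    | succ k ih =>
      rw [← ih]
      conv_rhs => rw [← h]
      simp; congr 1; ring
  rw [← sub_eq_zero]
  apply Polynomial.eq_zero_of_infinite_isRoot
  refine Set.Infinite.mono (s := Set.range (fun k : ℕ => (m : K) * k)) ?_ ?_
  · rintro _ ⟨k, rfl⟩; simp [h1]
  · apply Set.infinite_range_of_injective
    intro a b hab
    have : (m : K) ≠ 0 := by exact_mod_cast hm
    simpa [this] using hab

lemma unit_pair {D S : Module.End K (Polynomial K)} (h : D * S = 1) {P Q : ℤ →₀ Polynomial K}
    (hD : Symb D P) (hS : Symb S Q) {i j : ℤ} (hi : i ∈ P.support) (hj : j ∈ Q.support)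
    (hu : UniqueAdd P.support Q.support i j) :
    i + j = 0 ∧ Q j * (P i).comp (Polynomial.X + Polynomial.C (j : K)) = 1 := by
  have hp : Q j * (P i).comp (Polynomial.X + Polynomial.C (j : K)) =
      Polynomial.C (if i + j = 0 then 1 else 0) := by
    apply poly_eq
    filter_upwards [hD.mul hS, eventually_ge_atTop 0, eventually_ge_atTop (-(i + j))] with k h1 h2 h3
    have h4 := congrArg (cf K (k + (i + j))) h1
    rw [h, Module.End.one_apply, map_sum, Finset.sum_eq_single j, map_sum,
      Finset.sum_eq_single i, map_smul, cf_vv_self (by omega), cf_vv] at h4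
    · simp only [Polynomial.eval_mul, Polynomial.eval_comp, Polynomial.eval_add,
        Polynomial.eval_X, Polynomial.eval_C]
      rw [smul_eq_mul, mul_one] at h4
      rw [← h4]
      congr 1
      simp [h2]
    · intro b hb hne
      rw [map_smul, cf_vv_ne (by omega), smul_zero]
    · intro h; exact absurd hi h
    · intro b hb hne
      rw [map_sum]
      refine Finset.sum_eq_zero fun a ha => ?_
      rw [map_smul, cf_vv_ne, smul_zero]
      intro he
      exact hne (hu ha hb (by omega)).2
    · intro h; exact absurd hj h
  have hP : P i ≠ 0 := by simpa using hi
  have hQ : Q j ≠ 0 := by simpa using hj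
  have hne : Q j * (P i).comp (Polynomial.X + Polynomial.C (j : K)) ≠ 0 := by
    refine mul_ne_zero hQ ?_
    rw [← Polynomial.taylor_apply]
    intro h0
    exact hP ((Polynomial.taylor_eq_zero _ _).1 h0)
  by_cases h0 : i + j = 0
  · exact ⟨h0, by rw [hp, if_pos h0, Polynomial.C_1]⟩
  · rw [hp, if_neg h0] at hne; simp at hne

lemma unit_symb {D S : Module.End K (Polynomial K)} (h : D * S = 1) {P Q : ℤ →₀ Polynomial K}
    (hD : Symb D P) (hS : Symb S Q) : ∃ (m : ℤ) (c : K), c ≠ 0 ∧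
      P = Finsupp.single m (Polynomial.C c) ∧ Q = Finsupp.single (-m) (Polynomial.C c⁻¹) := by
  have hne : P.support.Nonempty ∧ Q.support.Nonempty := by
    by_contra hcon
    obtain ⟨k, h1, h2⟩ := ((hD.mul hS).and (eventually_ge_atTop 0)).exists
    have h3 : vv K k = 0 := by
      rw [h, Module.End.one_apply] at h1
      rw [h1]
      rw [not_and_or, Finset.not_nonempty_iff_eq_empty, Finset.not_nonempty_iff_eq_empty] at hcon
      rcases hcon with h | h <;> simp [h]
    have := cf_vv_self (K := K) h2
    rw [h3] at this; simp at this
  have hcard : P.support.card * Q.support.card = 1 := by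
    by_contra hcon
    have h1 : 0 < P.support.card * Q.support.card :=
      Nat.mul_pos hne.1.card_pos hne.2.card_pos
    obtain ⟨p, hp, q, hq, hpq, hup, huq⟩ :=
      TwoUniqueSums.uniqueAdd_of_one_lt_card (A := P.support) (B := Q.support) (by omega)
    rw [Finset.mem_product] at hp hq
    have e1 := (unit_pair h hD hS hp.1 hp.2 hup).1
    have e2 := (unit_pair h hD hS hq.1 hq.2 huq).1
    obtain ⟨a, b⟩ := hup hq.1 hq.2 (by omega)
    exact hpq (Prod.ext a.symm b.symm)
  have c1 : P.support.card = 1 := Nat.dvd_one.1 ⟨_, hcard.symm⟩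
  have c2 : Q.support.card = 1 := Nat.dvd_one.1 ⟨_, by rw [mul_comm]; exact hcard.symm⟩
  obtain ⟨i, hi⟩ := Finset.card_eq_one.1 c1
  obtain ⟨j, hj⟩ := Finset.card_eq_one.1 c2
  obtain ⟨e, he⟩ := unit_pair h hD hS (i := i) (j := j) (by simp [hi]) (by simp [hj])
    (by rw [hi, hj]; intro a b ha hb _; simp at ha hb; exact ⟨ha, hb⟩)
  obtain rfl : j = -i := by omega
  have u1 : IsUnit (Q (-i)) := IsUnit.of_mul_eq_one _ he
  obtain ⟨t, ht, hQ⟩ := Polynomial.isUnit_iff.1 u1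
  have ht0 : t ≠ 0 := ht.ne_zero
  have hPi : (P i).comp (Polynomial.X + Polynomial.C ((-i : ℤ) : K)) = Polynomial.C t⁻¹ := by
    rw [← hQ] at he
    calc _ = Polynomial.C t⁻¹ * (Polynomial.C t * (P i).comp (Polynomial.X + Polynomial.C ((-i : ℤ) : K))) := by
          rw [← mul_assoc, ← Polynomial.C_mul, inv_mul_cancel₀ ht0]; simp
      _ = _ := by rw [he, mul_one]
  have hPi' : P i = Polynomial.C t⁻¹ := by
    rw [← Polynomial.taylor_apply] at hPi
    apply Polynomial.taylor_injective ((-i : ℤ) : K)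
    rw [hPi, Polynomial.taylor_C]
  refine ⟨i, t⁻¹, inv_ne_zero ht0, ?_, ?_⟩
  · obtain ⟨_, h2⟩ := Finsupp.support_eq_singleton.1 hi
    rw [h2, hPi']
  · obtain ⟨_, h2⟩ := Finsupp.support_eq_singleton.1 hj
    rw [h2, ← hQ, inv_inv]

lemma T_symb {D T : Module.End K (Polynomial K)} (h : D * T = T * D + D)
    {R : ℤ →₀ Polynomial K} {m : ℤ} {c : K} (hc : c ≠ 0)
    (hD : Symb D (Finsupp.single m (Polynomial.C c))) (hT : Symb T R) (i : ℤ) :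
    R i = (R i).comp (Polynomial.X + Polynomial.C (m : K)) +
      Polynomial.C (if i = 0 then 1 else 0) := by
  apply poly_eq
  have hsupp : (Finsupp.single m (Polynomial.C c)).support = {m} :=
    Finsupp.support_single _ (by simpa using hc)
  filter_upwards [hD.mul hT, hT.mul hD, hD, eventually_ge_atTop (-(m + i))] with k h1 h2 h3 h4
  have h5 : (D * T) (vv K k) = (T * D + D) (vv K k) := by rw [h]
  rw [LinearMap.add_apply, h1, h2, h3, ev_single, hsupp] at h5
  simp only [Finset.sum_singleton, Finsupp.single_eq_same, Polynomial.eval_C] at h5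
  have h6 := congrArg (cf K (k + (m + i))) h5
  have aux : ∀ (f : ℤ → K) (g : ℤ → ℤ), (∀ j, g j = m + j) → (R i = 0 → f i = 0) →
      cf K (k + (m + i)) (∑ j ∈ R.support, f j • vv K (k + g j)) = f i := by
    intro f g hg hf
    rw [map_sum, Finset.sum_eq_single i]
    · rw [map_smul, hg, cf_vv_self (by omega), smul_eq_mul, mul_one]
    · intro j _ hj
      rw [map_smul, hg, cf_vv_ne (by omega), smul_zero]
    · intro hi
      rw [hf (by simpa using hi), zero_smul, map_zero]
  rw [map_add, aux _ (fun j => m + j) (fun _ => rfl) (by intro h; simp [h]),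
    aux _ (fun j => j + m) (fun _ => by ring) (by intro h; simp [h])] at h6
  have h7 : cf K (k + (m + i)) (c • vv K (k + m)) = c * (if i = 0 then 1 else 0) := by
    rw [map_smul, smul_eq_mul, cf_vv]
    congr 1
    by_cases hi : i = 0
    · subst hi; rw [if_pos rfl, if_pos]; exact ⟨by ring, by omega⟩
    · rw [if_neg hi, if_neg (by omega)]
  rw [h7] at h6
  simp only [Polynomial.eval_add, Polynomial.eval_comp, Polynomial.eval_X, Polynomial.eval_C]
  apply mul_left_cancel₀ hc
  rw [mul_comm, h6]; ring

lemma band_s7 {a : Module.End K (Polynomial K)} {P : ℤ →₀ Polynomial K} (ha : Symb a P) {d : ℤ}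
    (hd : ∀ i ∈ P.support, i ≤ d) :
    ∀ᶠ M : ℤ in atTop, ∀ k ≤ M, ∀ j, M + d < j → cf K j (a (vv K k)) = 0 := by
  obtain ⟨N, hN⟩ := eventually_atTop.1 ha
  have h1 : ∀ᶠ M : ℤ in atTop, ∀ k ∈ Finset.Ico 0 N, ∀ j, M + d < j → cf K j (a (vv K k)) = 0 := by
    rw [Filter.eventually_all_finset]
    intro k _
    filter_upwards [eventually_ge_atTop (((a (vv K k)).natDegree : ℤ) - d)] with M hM j hj
    have : 0 ≤ j := by omega
    lift j to ℕ using this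
    rw [cf_nat, Polynomial.coeff_eq_zero_of_natDegree_lt (by omega), mul_zero]
  filter_upwards [h1] with M hM k hk j hj
  rcases lt_or_ge k 0 with h0 | h0
  · rw [vv_neg h0]; simp
  rcases lt_or_ge k N with h2 | h2
  · exact hM k (by simp [h0, h2]) j hj
  · rw [hN k h2, ev_apply, map_sum]
    refine Finset.sum_eq_zero fun i hi => ?_
    have := hd i hi
    rw [map_smul, cf_vv_ne (by omega), smul_zero]

lemma not_inj {a : Module.End K (Polynomial K)} {m : ℤ} {q : Polynomial K}
    (ha : Symb a (Finsupp.single m q)) (hm : m < 0) : ¬ Function.Injective a := by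
  intro hinj
  obtain ⟨M, h1, h2⟩ := ((band_s7 ha (d := m) (by
    intro i hi
    have := Finsupp.support_single_subset hi
    simp at this; omega)).and (eventually_ge_atTop 0)).exists
  lift M to ℕ using h2
  have hmap : ∀ p ∈ Polynomial.degreeLT K (M + 1), a p ∈ Polynomial.degreeLT K M := by
    intro p hp
    rw [Polynomial.mem_degreeLT] at hp ⊢
    rw [Polynomial.degree_lt_iff_coeff_zero]
    intro j hj
    have h3 : cf K (j : ℤ) (a p) = 0 := by
      have hpd : p.natDegree < M + 1 := by
        rcases eq_or_ne p 0 with rfl | h0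
        · simp
        · exact (Polynomial.natDegree_lt_iff_degree_lt h0).2 hp
      rw [expand p _ hpd, map_sum, map_sum]
      refine Finset.sum_eq_zero fun k hk => ?_
      simp only [Finset.mem_range] at hk
      rw [map_smul, map_smul, h1 k (by omega) j (by omega), smul_zero]
    rw [cf_nat] at h3
    have : (j.factorial : K) ≠ 0 := by exact_mod_cast j.factorial_ne_zero
    simpa [this] using h3
  have hdim := LinearMap.finrank_le_finrank_of_injective (f := a.restrict hmap) (by
    intro x y hxy
    apply Subtype.ext
    apply hinj
    exact congrArg Subtype.val hxy)
  rw [(Polynomial.degreeLTEquiv K (M+1)).finrank_eq, (Polynomial.degreeLTEquiv K M).finrank_eq] at hdim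
  simp at hdim

lemma indep_of_eig {V : Type*} [AddCommGroup V] [Module K V] (T : Module.End K V) (w : ℕ → V)
    (h0 : ∀ i, w i ≠ 0) (hw : ∀ i, T (w i) = ((i : K) + 1) • w i) (U : Submodule K V)
    [Module.Finite K U] : ∃ i, w i ∉ U := by
  by_contra hcon
  push Not at hcon
  have hli : LinearIndependent K w := by
    refine Module.End.eigenvectors_linearIndependent' T (fun i : ℕ => (i : K) + 1) ?_ w ?_
    · intro a b hab; simpa using hab
    · intro i
      exact ⟨Module.End.mem_eigenspace_iff.2 (hw i), h0 i⟩
  have h2 : LinearIndependent K (fun i => (⟨w i, hcon i⟩ : U)) :=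
    LinearIndependent.of_comp U.subtype hli
  have := h2.finite
  exact not_finite ℕ

lemma no_raise {T : Module.End K (Polynomial K)} {R : ℤ →₀ Polynomial K} (hT : Symb T R)
    (w : ℕ → Polynomial K) (h0 : ∀ i, w i ≠ 0) (hw : ∀ i, T (w i) = ((i : K) + 1) • w i)
    {d : ℤ} (hd : ∀ i ∈ R.support, i ≤ d) (hpos : 0 < d) {r : K} (hr : R d = Polynomial.C r) :
    r = 0 := by
  obtain ⟨N1, hN1⟩ := eventually_atTop.1 (band_s7 hT hd)
  obtain ⟨N2, hN2⟩ := eventually_atTop.1 hT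
  obtain ⟨n, hn1, hn2⟩ : ∃ n : ℕ, N1 + 1 ≤ n ∧ N2 ≤ n := ⟨(max (N1 + 1) N2).toNat, by omega, by omega⟩
  have : Module.Finite K (Polynomial.degreeLT K n) :=
    Module.Finite.equiv (Polynomial.degreeLTEquiv K n).symm
  obtain ⟨i, hi⟩ := indep_of_eig T w h0 hw (Polynomial.degreeLT K n)
  have h0u := h0 i
  have hwu := hw i
  generalize w i = u at hi h0u hwu
  obtain ⟨M, hM⟩ : ∃ M, M = u.natDegree := ⟨_, rfl⟩
  have hMn : n ≤ M := by
    rw [Polynomial.mem_degreeLT, ← Polynomial.natDegree_lt_iff_degree_lt h0u] at hi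
    omega
  have e1 : cf K (M + d) (T u) = 0 := by
    rw [hwu, map_smul]
    have h1 : (M : ℤ) + d = ((M + d.toNat : ℕ) : ℤ) := by push_cast; omega
    rw [h1, cf_nat, Polynomial.coeff_eq_zero_of_natDegree_lt (by omega)]
    simp
  rw [expand u (M + 1) (by omega), map_sum, map_sum, Finset.sum_range_succ,
    Finset.sum_eq_zero, zero_add, map_smul, map_smul, hN2 _ (by omega), ev_apply, map_sum,
    Finset.sum_eq_single d, map_smul, cf_vv_self (by omega), hr, Polynomial.eval_C, cf_nat] at e1
  · have h1 : (M.factorial : K) ≠ 0 := by exact_mod_cast M.factorial_ne_zero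
    have h2 : u.coeff M ≠ 0 := by
      rw [hM, Polynomial.coeff_natDegree]; simpa using h0u
    simpa [h1, h2, h0u] using e1
  · intro j _ hj
    rw [map_smul, cf_vv_ne (by omega), smul_zero]
  · intro hj
    have : R d = 0 := by simpa using hj
    simp [this]
  · intro k hk
    simp only [Finset.mem_range] at hk
    rw [map_smul, map_smul, hN1 (M - 1) (by omega) k (by omega) _ (by omega), smul_zero]

/-- functionals supported below `n` -/
def lowF (K : Type*) [Field K] [CharZero K] (n : ℕ) : Submodule K (Polynomial K →ₗ[K] K) where
  carrier := {φ | ∀ k : ℕ, n ≤ k → φ (vv K k) = 0}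
  zero_mem' := by intro k _; rfl
  add_mem' := by intro a b ha hb k hk; simp [ha k hk, hb k hk]
  smul_mem' := by intro c a ha k hk; simp [ha k hk]

instance lowF_finite (n : ℕ) : Module.Finite K (lowF K n) := by
  let f : lowF K n →ₗ[K] (Fin n → K) :=
    { toFun := fun φ i => φ.1 (vv K (i : ℕ))
      map_add' := by intro a b; rfl
      map_smul' := by intro a b; rfl }
  refine Module.Finite.of_injective f ?_
  intro a b hab
  apply Subtype.ext
  apply ext_vv
  intro k
  by_cases hk : n ≤ k
  · rw [a.2 k hk, b.2 k hk]
  · exact congrFun hab ⟨k, by omega⟩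

lemma no_lower {T : Module.End K (Polynomial K)} {R : ℤ →₀ Polynomial K} (hT : Symb T R)
    (w : ℕ → (Polynomial K →ₗ[K] K)) (h0 : ∀ i, w i ≠ 0)
    (hw : ∀ i, (w i).comp T = ((i : K) + 1) • w i)
    (hf : ∀ i, ∀ᶠ k : ℤ in atTop, w i (vv K k) = 0)
    {d : ℤ} (hd : ∀ i ∈ R.support, d ≤ i) (hneg : d < 0) {r : K} (hr : R d = Polynomial.C r) :
    r = 0 := by
  obtain ⟨N2, hN2⟩ := eventually_atTop.1 hT
  let T' : Module.End K (Polynomial K →ₗ[K] K) :=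
    { toFun := fun φ => φ.comp T
      map_add' := by intro a b; rfl
      map_smul' := by intro a b; rfl }
  obtain ⟨i, hi⟩ := indep_of_eig T' w h0 hw (lowF K N2.toNat)
  set u := w i with hu
  have hi' : ∃ k : ℕ, N2.toNat ≤ k ∧ u (vv K k) ≠ 0 := by
    by_contra hcon
    push Not at hcon
    exact hi hcon
  obtain ⟨k, hk1, hk2⟩ := hi'
  obtain ⟨B, hB⟩ := eventually_atTop.1 (hf i)
  obtain ⟨M, hM1, hM2⟩ := Int.exists_greatest_of_bdd (P := fun z : ℤ => u (vv K z) ≠ 0)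
    ⟨B, fun z hz => by
      by_contra hcon
      exact hz (hB z (by omega))⟩ ⟨k, hk2⟩
  have hkM := hM2 k hk2
  have hz : ∀ z, M < z → u (vv K z) = 0 := by
    intro z hz
    by_contra hcon
    have := hM2 z hcon
    omega
  have e1 : u (T (vv K (M - d))) = 0 := by
    have := LinearMap.congr_fun (hw i) (vv K (M - d))
    rw [LinearMap.comp_apply] at this
    rw [this, LinearMap.smul_apply, hz _ (by omega), smul_zero]
  rw [hN2 _ (by omega), ev_apply, map_sum, Finset.sum_eq_single d, map_smul, hr,
    Polynomial.eval_C, sub_add_cancel] at e1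
  · simpa [hM1] using e1
  · intro j hj hne
    have := hd j hj
    rw [map_smul, hz _ (by omega), smul_zero]
  · intro hj
    have : R d = 0 := by simpa using hj
    simp [this]

lemma core {D S T : Module.End K (Polynomial K)} (hD : D ∈ I1 K) (hS : S ∈ I1 K) (hT : T ∈ I1 K)
    (h1 : D * S = 1) (h2 : D * T = T * D + D) (h3 : T * S = S * T + S)
    (h4 : T * (1 - S * D) = 1 - S * D) (h5 : (1 - S * D) * T = 1 - S * D) :
    ∃ ν : K, ν ≠ 0 ∧ ∃ n : ℕ, 0 < n ∧
      ∃ (μ : K) (h f g : Module.End K (Polynomial K)),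
        h ∈ Fspan K ∧ f ∈ Fspan K ∧ g ∈ Fspan K ∧
        T = ((n : K))⁻¹ • Hop K + μ • (1 : Module.End K (Polynomial K)) + h ∧
        S = ν • intOp K ^ n + f ∧
        D = ν⁻¹ • derOp K ^ n + g := by
  obtain ⟨P, hP⟩ := exists_rep_s7 hD
  obtain ⟨Q, hQ⟩ := exists_rep_s7 hS
  obtain ⟨R, hR⟩ := exists_rep_s7 hT
  obtain ⟨m, c, hc, rfl, rfl⟩ := unit_symb h1 hP hQ
  have hDS : ∀ x, D (S x) = x := fun x => by
    rw [← Module.End.mul_apply, h1, Module.End.one_apply]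
  have hdiff := T_symb h2 hc hP hR
  have hm : m < 0 := by
    rcases lt_trichotomy m 0 with h | h | h
    · exact h
    · subst h
      have := hdiff 0
      simp at this
    · exact absurd (Function.LeftInverse.injective hDS) (not_inj hQ (by omega))
  have hm0 : (m : K) ≠ 0 := by exact_mod_cast hm.ne
  have hconst : ∀ i, i ≠ 0 → R i = Polynomial.C ((R i).eval 0) := by
    intro i hi
    apply poly_periodic hm.ne
    have := hdiff i
    rw [if_neg hi, Polynomial.C_0, add_zero] at this
    exact this.symm
  obtain ⟨μ', hμ'⟩ : ∃ μ' : K, R 0 = Polynomial.C (-(m : K)⁻¹) * Polynomial.X + Polynomial.C μ' := by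
    have h := poly_periodic (f := R 0 + Polynomial.C ((m : K)⁻¹) * Polynomial.X) hm.ne (by
      have h := hdiff 0
      rw [if_pos rfl] at h
      conv_rhs => rw [h]
      simp only [Polynomial.add_comp, Polynomial.mul_comp, Polynomial.C_comp, Polynomial.X_comp]
      rw [mul_add, ← Polynomial.C_mul, inv_mul_cancel₀ hm0]
      ring)
    refine ⟨(R 0 + Polynomial.C ((m : K)⁻¹) * Polynomial.X).eval 0, ?_⟩
    · rw [Polynomial.C_neg, neg_mul, ← h]; ring
  -- the idempotent
  have he : (1 - S * D) ≠ 0 := by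
    intro h
    refine not_inj hP hm ?_
    have hSD : ∀ x, S (D x) = x := fun x => by
      rw [← Module.End.mul_apply, ← sub_eq_zero.1 h, Module.End.one_apply]
    exact Function.LeftInverse.injective hSD
  obtain ⟨u, hu⟩ : ∃ u, (1 - S * D) u ≠ 0 := by
    by_contra hcon
    push Not at hcon
    exact he (LinearMap.ext hcon)
  have hSinj : Function.Injective S := Function.LeftInverse.injective hDS
  have hDsurj : Function.Surjective D := Function.RightInverse.surjective hDS
  -- eigenvectors
  let w : ℕ → Polynomial K := fun i => (S ^ i) ((1 - S * D) u)
  have hw_succ : ∀ i, w (i + 1) = S (w i) := fun i => by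
    simp only [w, pow_succ', Module.End.mul_apply]
  have hw0 : ∀ i, w i ≠ 0 := by
    intro i
    induction i with
    | zero => simpa [w] using hu
    | succ i ih =>
      rw [hw_succ]
      intro h
      exact ih (hSinj (by rw [h, map_zero]))
  have hwT : ∀ i, T (w i) = ((i : K) + 1) • w i := by
    intro i
    induction i with
    | zero =>
      have := LinearMap.congr_fun h4 u
      rw [Module.End.mul_apply] at this
      simp only [w, pow_zero, Module.End.one_apply, this]
      simp
    | succ i ih =>
      have := LinearMap.congr_fun h3 (w i)
      rw [Module.End.mul_apply, LinearMap.add_apply, Module.End.mul_apply, ih, map_smul] at this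
      rw [hw_succ, this]
      push_cast
      module
  obtain ⟨z, hz⟩ : ∃ z : ℕ, ((1 - S * D) u).coeff z ≠ 0 := by
    by_contra hcon
    push Not at hcon
    exact hu (Polynomial.ext hcon)
  let φ : ℕ → (Polynomial K →ₗ[K] K) := fun i =>
    ((Polynomial.lcoeff K z).comp (1 - S * D)).comp (D ^ i)
  have hφ_succ : ∀ i x, φ (i + 1) x = φ i (D x) := fun i x => by
    simp only [φ, pow_succ, LinearMap.comp_apply, Module.End.mul_apply]
  have hφ_zero : ∀ x, φ 0 x = ((1 - S * D) x).coeff z := fun x => by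
    simp [φ]
  have hφ0 : ∀ i, φ i ≠ 0 := by
    intro i
    induction i with
    | zero =>
      intro h
      apply hz
      rw [← hφ_zero, h]; rfl
    | succ i ih =>
      intro h
      apply ih
      refine LinearMap.ext fun x => ?_
      obtain ⟨y, rfl⟩ := hDsurj x
      rw [← hφ_succ, h]; rfl
  have hφT : ∀ i, (φ i).comp T = ((i : K) + 1) • φ i := by
    intro i
    induction i with
    | zero =>
      refine LinearMap.ext fun x => ?_
      have := LinearMap.congr_fun h5 x
      rw [Module.End.mul_apply] at this
      rw [LinearMap.comp_apply, hφ_zero, this, LinearMap.smul_apply, hφ_zero]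
      simp
    | succ i ih =>
      refine LinearMap.ext fun x => ?_
      have := LinearMap.congr_fun h2 x
      rw [Module.End.mul_apply, LinearMap.add_apply, Module.End.mul_apply] at this
      have ih' := LinearMap.congr_fun ih (D x)
      rw [LinearMap.comp_apply, LinearMap.smul_apply] at ih'
      rw [LinearMap.comp_apply, hφ_succ, this, map_add, ih', LinearMap.smul_apply, hφ_succ]
      push_cast
      module
  have hshift : Tendsto (fun k : ℤ => k + m) atTop atTop :=
    tendsto_atTop_add_const_right atTop m tendsto_id
  have hφf : ∀ i, ∀ᶠ k : ℤ in atTop, φ i (vv K k) = 0 := by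
    intro i
    induction i with
    | zero =>
      filter_upwards [hP, hshift.eventually hQ] with k hk1 hk2
      rw [hφ_zero, LinearMap.sub_apply, Module.End.mul_apply, hk1, ev_single, map_smul, hk2,
        ev_single, Polynomial.eval_C, Polynomial.eval_C, smul_smul, mul_inv_cancel₀ hc,
        add_neg_cancel_right]
      simp
    | succ i ih =>
      filter_upwards [hP, hshift.eventually ih] with k hk1 hk2
      rw [hφ_succ, hk1, ev_single, map_smul, hk2, smul_zero]
  have hR0 : ∀ i, i ≠ 0 → R i = 0 := by
    intro i hi
    by_contra hne
    have hmem : i ∈ R.support := by simpa using hne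
    rcases lt_or_gt_of_ne hi with hlt | hgt
    · set d := R.support.min' ⟨i, hmem⟩ with hd
      have hdi : d ≤ i := Finset.min'_le _ _ hmem
      have hds : d ∈ R.support := Finset.min'_mem _ _
      have := no_lower hR φ hφ0 hφT hφf (d := d) (fun j hj => Finset.min'_le _ _ hj) (by omega)
        (hconst d (by omega))
      have h0 := hconst d (by omega)
      rw [this, Polynomial.C_0] at h0
      exact (Finsupp.mem_support_iff.1 hds) h0
    · set d := R.support.max' ⟨i, hmem⟩ with hd
      have hdi : i ≤ d := Finset.le_max' _ _ hmem
      have hds : d ∈ R.support := Finset.max'_mem _ _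
      have := no_raise hR w hw0 hwT (d := d) (fun j hj => Finset.le_max' _ _ hj) (by omega)
        (hconst d (by omega))
      have h0 := hconst d (by omega)
      rw [this, Polynomial.C_0] at h0
      exact (Finsupp.mem_support_iff.1 hds) h0
  have hRs : R = Finsupp.single 0 (R 0) := by
    ext1 i
    by_cases hi : i = 0
    · subst hi; simp
    · rw [hR0 i hi, Finsupp.single_eq_of_ne hi]
  obtain ⟨n, rfl⟩ : ∃ n : ℕ, m = -n := ⟨(-m).toNat, by omega⟩
  have hn : 0 < n := by omega
  have hnK : (n : K) ≠ 0 := by exact_mod_cast hn.ne'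
  refine ⟨c⁻¹, inv_ne_zero hc, n, hn, μ' - (n : K)⁻¹, T - ((n : K)⁻¹ • Hop K + (μ' - (n : K)⁻¹) • 1),
    S - c⁻¹ • intOp K ^ n, D - c⁻¹⁻¹ • derOp K ^ n, mem_F_s7 ?_, mem_F_s7 ?_, mem_F_s7 ?_, ?_, ?_, ?_⟩
  · filter_upwards [hR] with k hk
    rw [hRs, ev_single, hμ'] at hk
    rw [LinearMap.sub_apply, hk, LinearMap.add_apply, LinearMap.smul_apply, LinearMap.smul_apply,
      H_vv, Module.End.one_apply]
    simp only [Polynomial.eval_add, Polynomial.eval_mul, Polynomial.eval_C, Polynomial.eval_X,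
      add_zero]
    push_cast
    rw [inv_neg, neg_neg]
    module
  · filter_upwards [hQ, eventually_ge_atTop 0] with k hk hk0
    rw [LinearMap.sub_apply, hk, LinearMap.smul_apply, int_pow_vv _ hk0, ev_single]
    simp
  · filter_upwards [hP] with k hk
    rw [LinearMap.sub_apply, hk, LinearMap.smul_apply, der_pow_vv, ev_single]
    simp [sub_eq_add_neg]
  · abel
  · abel
  · abel

lemma rel1 : DelI K * IntI K = 1 := by
  apply Subtype.ext
  change derOp K * intOp K = 1
  apply ext_vv; intro k
  rw [Module.End.mul_apply, int_vv (by omega), der_vv]; simp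

lemma rel2 : DelI K * HelI K = HelI K * DelI K + DelI K := by
  apply Subtype.ext
  change derOp K * Hop K = Hop K * derOp K + derOp K
  apply ext_vv; intro k
  rw [LinearMap.add_apply, Module.End.mul_apply, Module.End.mul_apply, H_vv, map_smul, der_vv, H_vv]
  push_cast; module

lemma rel3 : HelI K * IntI K = IntI K * HelI K + IntI K := by
  apply Subtype.ext
  change Hop K * intOp K = intOp K * Hop K + intOp K
  apply ext_vv; intro k
  rw [LinearMap.add_apply, Module.End.mul_apply, Module.End.mul_apply, H_vv, map_smul,
    int_vv (by omega), H_vv]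
  push_cast; module

lemma e00_vv (k : ℕ) : (1 - intOp K * derOp K) (vv K k) = if k = 0 then vv K 0 else 0 := by
  have := e_vv (K := K) 0 0 k
  simpa [eOp] using this

lemma rel4 : HelI K * (1 - IntI K * DelI K) = 1 - IntI K * DelI K := by
  apply Subtype.ext
  change Hop K * (1 - intOp K * derOp K) = 1 - intOp K * derOp K
  apply ext_vv; intro k
  rw [Module.End.mul_apply, e00_vv]
  split_ifs
  · rw [H_vv]; simp
  · simp

lemma rel5 : (1 - IntI K * DelI K) * HelI K = 1 - IntI K * DelI K := by
  apply Subtype.ext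
  change (1 - intOp K * derOp K) * Hop K = 1 - intOp K * derOp K
  apply ext_vv; intro k
  rw [Module.End.mul_apply, H_vv, map_smul, e00_vv]
  split_ifs with h
  · subst h; simp
  · simp

end helpers

/-- For every `K`-algebra endomorphism `σ` of `I₁` there exist a nonzero
scalar `ν ∈ K`, a positive integer `n`, a scalar `μ ∈ K` and `h, f, g ∈ F` such that
`σ(H) = (1/n)•H + μ•1 + h`, `σ(∫) = ν•∫ⁿ + f` and `σ(∂) = ν⁻¹•∂ⁿ + g`. -/
theorem sigma_on_generators (σ : I1 K →ₐ[K] I1 K) :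
    ∃ ν : K, ν ≠ 0 ∧ ∃ n : ℕ, 0 < n ∧
      ∃ (μ : K) (h f g : Module.End K (Polynomial K)),
        h ∈ Fspan K ∧ f ∈ Fspan K ∧ g ∈ Fspan K ∧
        ((σ (HelI K) : I1 K) : Module.End K (Polynomial K)) =
          ((n : K))⁻¹ • Hop K + μ • (1 : Module.End K (Polynomial K)) + h ∧
        ((σ (IntI K) : I1 K) : Module.End K (Polynomial K)) = ν • intOp K ^ n + f ∧
        ((σ (DelI K) : I1 K) : Module.End K (Polynomial K)) = ν⁻¹ • derOp K ^ n + g := by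
  have r1 := congrArg (fun x => ((σ x : I1 K) : Module.End K (Polynomial K))) (rel1 (K := K))
  have r2 := congrArg (fun x => ((σ x : I1 K) : Module.End K (Polynomial K))) (rel2 (K := K))
  have r3 := congrArg (fun x => ((σ x : I1 K) : Module.End K (Polynomial K))) (rel3 (K := K))
  have r4 := congrArg (fun x => ((σ x : I1 K) : Module.End K (Polynomial K))) (rel4 (K := K))
  have r5 := congrArg (fun x => ((σ x : I1 K) : Module.End K (Polynomial K))) (rel5 (K := K))
  have hs : σ (1 - IntI K * DelI K) = 1 - σ (IntI K) * σ (DelI K) := by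
    have h := congrArg σ (sub_add_cancel (1 : I1 K) (IntI K * DelI K))
    rw [map_add, map_mul, map_one] at h
    exact eq_sub_of_add_eq (G := I1 K) h
  have hs' : ((1 - σ (IntI K) * σ (DelI K) : I1 K) : Module.End K (Polynomial K)) =
      1 - (σ (IntI K) : Module.End K (Polynomial K)) * σ (DelI K) := rfl
  simp only [map_mul, map_add, hs, hs', map_one, MulMemClass.coe_mul, AddMemClass.coe_add,
    OneMemClass.coe_one] at r1 r2 r3 r4 r5
  exact core (σ (DelI K)).2 (σ (IntI K)).2 (σ (HelI K)).2 r1 r2 r3 r4 r5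

end
end

section
/- For every K-algebra endomorphism σ of I_1, the σ-twisted I_1-module ^σK[x] (underlying K-vector space K[x], with action a · p := σ(a)(p) for a ∈ I_1, p ∈ K[x]) is isomorphic as an I_1-module to the natural I_1-module K[x] (where a · p := a(p)). -/
set_option linter.unusedSectionVars false

open Polynomial

noncomputable section

variable (K : Type*) [Field K] [CharZero K]

section helpers

variable {K}

namespace TW

open Filter

/-- The divided power basis, indexed by integers (zero for negative indices). -/
def u (K : Type*) [Field K] (k : ℤ) : Polynomial K :=
  if k < 0 then 0 else Polynomial.monomial k.toNat ((k.toNat.factorial : K)⁻¹)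

/-- Coordinates with respect to `u`. -/
def cu (K : Type*) [Field K] (m : ℤ) : Polynomial K →ₗ[K] K :=
  (m.toNat.factorial : K) • Polynomial.lcoeff K m.toNat

lemma u_nat (n : ℕ) : u K n = Polynomial.monomial n ((n.factorial : K)⁻¹) := by
  simp [u]

lemma u_neg {k : ℤ} (h : k < 0) : u K k = 0 := by simp [u, h]

lemma cu_u {m : ℤ} (hm : 0 ≤ m) (k : ℤ) : cu K m (u K k) = if k = m then 1 else 0 := by
  have hf : (m.toNat.factorial : K) ≠ 0 := by exact_mod_cast Nat.factorial_ne_zero _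
  rcases lt_or_ge k 0 with h | h
  · rw [u_neg h, if_neg (by omega)]; simp
  · obtain ⟨k, rfl⟩ := Int.eq_ofNat_of_zero_le h
    obtain ⟨m, rfl⟩ := Int.eq_ofNat_of_zero_le hm
    rw [u_nat]
    simp only [cu, LinearMap.smul_apply, Polynomial.lcoeff_apply, Polynomial.coeff_monomial]
    by_cases e : k = m
    · subst e; simpa using mul_inv_cancel₀ hf
    · simp [e]

lemma u_ne_zero {k : ℤ} (hk : 0 ≤ k) : u K k ≠ 0 := by
  intro h
  have := cu_u (K := K) hk k
  simp [h] at this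

lemma der_u (k : ℤ) : derOp K (u K k) = u K (k - 1) := by
  rcases lt_or_ge k 0 with h | h
  · rw [u_neg h, u_neg (by omega)]; simp
  · obtain ⟨k, rfl⟩ := Int.eq_ofNat_of_zero_le h
    rw [u_nat]
    rcases k with _ | k
    · rw [u_neg (by simp)]; simp [derOp]
    · have : ((k + 1 : ℕ) : ℤ) - 1 = (k : ℕ) := by simp
      rw [this, u_nat]
      simp only [derOp, Polynomial.derivative_monomial, Nat.add_sub_cancel]
      congr 1
      have h1 : ((k : K) + 1) ≠ 0 := by exact_mod_cast Nat.succ_ne_zero k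
      have h2 : (k.factorial : K) ≠ 0 := by exact_mod_cast Nat.factorial_ne_zero k
      rw [Nat.factorial_succ]; push_cast; field_simp

lemma int_u {k : ℤ} (h : 0 ≤ k) : intOp K (u K k) = u K (k + 1) := by
  obtain ⟨k, rfl⟩ := Int.eq_ofNat_of_zero_le h
  have : ((k : ℕ) : ℤ) + 1 = (k + 1 : ℕ) := by simp
  rw [this, u_nat, u_nat]
  simp only [intOp, Polynomial.lsum_apply]
  rw [Polynomial.sum_monomial_index _ _ (by simp)]
  simp only [LinearMap.smul_apply, Polynomial.smul_monomial, smul_eq_mul]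
  congr 1
  rw [Nat.factorial_succ]; push_cast; rw [mul_inv]

lemma x_u {k : ℤ} (h : 0 ≤ k) : xOp K (u K k) = ((k : K) + 1) • u K (k + 1) := by
  obtain ⟨k, rfl⟩ := Int.eq_ofNat_of_zero_le h
  have : ((k : ℕ) : ℤ) + 1 = (k + 1 : ℕ) := by simp
  rw [this, u_nat, u_nat]
  simp only [xOp, LinearMap.mulLeft_apply, Polynomial.X_mul_monomial, Polynomial.smul_monomial,
    smul_eq_mul]
  congr 1
  have h1 : ((k : K) + 1) ≠ 0 := by exact_mod_cast Nat.succ_ne_zero k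
  have h2 : (k.factorial : K) ≠ 0 := by exact_mod_cast Nat.factorial_ne_zero k
  rw [Nat.factorial_succ]; push_cast; field_simp

lemma span_u : Submodule.span K (Set.range fun n : ℕ => u K n) = ⊤ := by
  rw [eq_top_iff]
  intro p _
  rw [p.as_sum_support]
  refine Submodule.sum_mem _ fun n _ => ?_
  have h2 : (n.factorial : K) ≠ 0 := by exact_mod_cast Nat.factorial_ne_zero n
  have : Polynomial.monomial n (p.coeff n) = (p.coeff n * n.factorial) • u K n := by
    rw [u_nat, Polynomial.smul_monomial, smul_eq_mul, mul_assoc, mul_inv_cancel₀ h2, mul_one]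
  rw [this]
  exact Submodule.smul_mem _ _ (Submodule.subset_span ⟨n, rfl⟩)

lemma ext_u {M : Type*} [AddCommGroup M] [Module K M] {f g : Polynomial K →ₗ[K] M}
    (h : ∀ n : ℕ, f (u K n) = g (u K n)) : f = g := by
  apply LinearMap.ext_on_range span_u
  exact h

lemma der_int : derOp K * intOp K = 1 := by
  apply ext_u
  intro n
  rw [Module.End.mul_apply, int_u (by positivity), der_u]; simp

lemma weyl : derOp K * xOp K - xOp K * derOp K = 1 := by
  refine LinearMap.ext fun p => ?_
  simp [derOp, xOp, Polynomial.derivative_mul]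

lemma x_eq : xOp K = intOp K * (derOp K * xOp K) := by
  apply ext_u
  intro n
  rw [Module.End.mul_apply, Module.End.mul_apply, x_u (by positivity), map_smul, map_smul, der_u,
    int_u (by omega)]
  simp

/-- symbols -/
def act (s : ℤ →₀ Polynomial K) (k : ℤ) : Polynomial K :=
  s.sum fun i p => p.eval (k : K) • u K (k + i)

def HasSym (a : Module.End K (Polynomial K)) (s : ℤ →₀ Polynomial K) : Prop :=
  ∀ᶠ k : ℤ in atTop, a (u K k) = act s k

lemma act_single (i : ℤ) (p : Polynomial K) (k : ℤ) :
    act (Finsupp.single i p) k = p.eval (k : K) • u K (k + i) := by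
  simp [act]

lemma act_add (s t : ℤ →₀ Polynomial K) (k : ℤ) : act (s + t) k = act s k + act t k := by
  unfold act
  rw [Finsupp.sum_add_index']
  · simp
  · intro i p q; simp [add_smul]

lemma act_zero (k : ℤ) : act (0 : ℤ →₀ Polynomial K) k = 0 := by simp [act]

lemma act_fsum {ι : Type*} (A : Finset ι) (f : ι → (ℤ →₀ Polynomial K)) (k : ℤ) :
    act (∑ i ∈ A, f i) k = ∑ i ∈ A, act (f i) k := by
  classical
  induction A using Finset.induction_on with
  | empty => simp [act_zero]
  | insert a A ha ih => rw [Finset.sum_insert ha, Finset.sum_insert ha, act_add, ih]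

lemma ev_shift {P : ℤ → Prop} (h : ∀ᶠ k : ℤ in atTop, P k) (j : ℤ) :
    ∀ᶠ k : ℤ in atTop, P (k + j) :=
  (tendsto_atTop_add_const_right atTop j tendsto_id).eventually h

lemma mul_formula {a b : Module.End K (Polynomial K)} {s t : ℤ →₀ Polynomial K}
    (ha : HasSym a s) (hb : HasSym b t) :
    ∀ᶠ k : ℤ in atTop, (a * b) (u K k) = ∑ j ∈ t.support, ∑ i ∈ s.support,
      ((t j).eval (k : K) * (s i).eval ((k + j : ℤ) : K)) • u K (k + j + i) := by
  have h1 : ∀ᶠ k : ℤ in atTop, ∀ j ∈ t.support, a (u K (k + j)) = act s (k + j) := by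
    rw [Filter.eventually_all_finset]
    intro j _
    exact ev_shift ha j
  filter_upwards [h1, hb] with k h1 h2
  rw [Module.End.mul_apply, h2, act, Finsupp.sum, map_sum]
  refine Finset.sum_congr rfl fun j hj => ?_
  rw [map_smul, h1 j hj, act, Finsupp.sum, Finset.smul_sum]
  refine Finset.sum_congr rfl fun i hi => ?_
  rw [smul_smul]

lemma exists_sym {a : Module.End K (Polynomial K)} (ha : a ∈ I1 K) : ∃ s, HasSym a s := by
  induction ha using Algebra.adjoin_induction with
  | mem x hx =>
    rcases hx with rfl | rfl | rfl
    · refine ⟨Finsupp.single 1 (Polynomial.X + 1), ?_⟩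
      filter_upwards [eventually_ge_atTop 0] with k hk
      rw [act_single, x_u hk]; simp
    · refine ⟨Finsupp.single (-1) 1, ?_⟩
      filter_upwards [eventually_ge_atTop 0] with k hk
      rw [act_single, der_u]; simp [sub_eq_add_neg]
    · refine ⟨Finsupp.single 1 1, ?_⟩
      filter_upwards [eventually_ge_atTop 0] with k hk
      rw [act_single, int_u hk]; simp
  | algebraMap r =>
    refine ⟨Finsupp.single 0 (Polynomial.C r), ?_⟩
    filter_upwards with k
    rw [act_single]; simp
  | add a b _ _ ha hb =>
    obtain ⟨s, hs⟩ := ha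
    obtain ⟨t, ht⟩ := hb
    refine ⟨s + t, ?_⟩
    filter_upwards [hs, ht] with k h1 h2
    rw [act_add, LinearMap.add_apply, h1, h2]
  | mul a b _ _ ha hb =>
    obtain ⟨s, hs⟩ := ha
    obtain ⟨t, ht⟩ := hb
    refine ⟨∑ j ∈ t.support, ∑ i ∈ s.support,
      Finsupp.single (j + i) (t j * (s i).comp (Polynomial.X + Polynomial.C (j : K))), ?_⟩
    filter_upwards [mul_formula hs ht] with k hk
    rw [hk]
    simp only [act_fsum, act_single]
    refine Finset.sum_congr rfl fun j hj => Finset.sum_congr rfl fun i hi => ?_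
    simp [add_assoc]

lemma poly_zero {p : Polynomial K} (h : ∃ᶠ k : ℤ in atTop, p.eval (k : K) = 0) : p = 0 := by
  apply Polynomial.eq_zero_of_infinite_isRoot
  have h1 : {k : ℤ | p.eval (k : K) = 0}.Infinite := by
    intro hf
    obtain ⟨B, hB⟩ := hf.bddAbove
    obtain ⟨k, h1, h2⟩ := (h.and_eventually (eventually_gt_atTop B)).exists
    exact absurd (hB h1) (not_le.mpr h2)
  refine (h1.image (f := fun k : ℤ => (k : K)) (Int.cast_injective.injOn)).mono ?_
  rintro _ ⟨k, hk, rfl⟩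
  exact hk

lemma poly_ne {p : Polynomial K} (h : p ≠ 0) : ∀ᶠ k : ℤ in atTop, p.eval (k : K) ≠ 0 := by
  by_contra hc
  exact h (poly_zero hc)

lemma poly_ev {p q : Polynomial K} (h : ∀ᶠ k : ℤ in atTop, p.eval (k : K) = q.eval (k : K)) :
    p = q := by
  rw [← sub_eq_zero]
  apply poly_zero
  refine Eventually.frequently ?_
  filter_upwards [h] with k hk
  simp [hk]

lemma cu_act {s : ℤ →₀ Polynomial K} {k i : ℤ} (h : 0 ≤ k + i) :
    cu K (k + i) (act s k) = (s i).eval (k : K) := by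
  classical
  rw [act, Finsupp.sum, map_sum]
  simp only [map_smul, cu_u h, add_right_inj, smul_eq_mul, mul_ite, mul_one, mul_zero]
  rw [Finset.sum_ite_eq']
  split_ifs with h
  · rfl
  · simp [Finsupp.notMem_support_iff.mp h]

/-- If `D * J = 1` then the symbol of `D` is homogeneous with constant coefficient. -/
lemma homog {D J : Module.End K (Polynomial K)} (hD : D ∈ I1 K) (hJ : J ∈ I1 K) (h : D * J = 1) :
    ∃ (r : ℤ) (l : K), l ≠ 0 ∧ HasSym D (Finsupp.single (-r) (Polynomial.C l)) := by
  classical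
  obtain ⟨s, hs⟩ := exists_sym hD
  obtain ⟨t, ht⟩ := exists_sym hJ
  have hm := mul_formula hs ht
  have hcoef : ∀ n : ℤ, ∀ᶠ k : ℤ in atTop, (if n = 0 then (1 : K) else 0) =
      ∑ j ∈ t.support, ∑ i ∈ s.support,
        if j + i = n then ((t j).eval (k : K) * (s i).eval ((k + j : ℤ) : K)) else 0 := by
    intro n
    filter_upwards [hm, eventually_ge_atTop 0, eventually_ge_atTop (-n)] with k hk h0 hn
    have h1 := congrArg (cu K (k + n)) hk
    rw [h, Module.End.one_apply, cu_u (by omega), map_sum] at h1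
    have e : (k = k + n) ↔ n = 0 := by omega
    simp only [e] at h1
    rw [h1]
    refine Finset.sum_congr rfl fun j hj => ?_
    rw [map_sum]
    refine Finset.sum_congr rfl fun i hi => ?_
    rw [map_smul, cu_u (by omega), smul_eq_mul, mul_ite, mul_one, mul_zero]
    have e : (k + j + i = k + n) ↔ j + i = n := by omega
    simp only [e]
  have huniq : ∀ j0 ∈ t.support, ∀ i0 ∈ s.support, UniqueAdd t.support s.support j0 i0 →
      (∀ᶠ k : ℤ in atTop, (if j0 + i0 = 0 then (1 : K) else 0) =
        (t j0).eval (k : K) * (s i0).eval ((k + j0 : ℤ) : K)) ∧ j0 + i0 = 0 := by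
    intro j0 hj0 i0 hi0 hu
    have key : ∀ᶠ k : ℤ in atTop, (if j0 + i0 = 0 then (1 : K) else 0) =
        (t j0).eval (k : K) * (s i0).eval ((k + j0 : ℤ) : K) := by
      filter_upwards [hcoef (j0 + i0)] with k hk
      rw [hk, Finset.sum_eq_single j0, Finset.sum_eq_single i0]
      · simp
      · intro i hi hne
        rw [if_neg]
        intro e
        exact hne (hu hj0 hi e).2
      · intro h; exact absurd hi0 h
      · intro j hj hne
        refine Finset.sum_eq_zero fun i hi => ?_
        rw [if_neg]
        intro e
        exact hne (hu hj hi e).1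
      · intro h; exact absurd hj0 h
    refine ⟨key, ?_⟩
    by_contra hne
    obtain ⟨k, h1, h2, h3⟩ := (key.and ((poly_ne (Finsupp.mem_support_iff.mp hj0)).and
      (ev_shift (poly_ne (Finsupp.mem_support_iff.mp hi0)) j0))).exists
    rw [if_neg hne] at h1
    exact (mul_ne_zero h2 h3) h1.symm
  have hcard : ¬ 1 < t.support.card * s.support.card := by
    intro hc
    obtain ⟨p1, h1, p2, h2, hne, u1, u2⟩ := TwoUniqueSums.uniqueAdd_of_one_lt_card hc
    rw [Finset.mem_product] at h1 h2
    have e1 := (huniq _ h1.1 _ h1.2 u1).2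
    have e2 := (huniq _ h2.1 _ h2.2 u2).2
    have := u1 h2.1 h2.2 (by rw [e1, e2])
    exact hne (Prod.ext this.1.symm this.2.symm)
  have hne : t.support.Nonempty ∧ s.support.Nonempty := by
    by_contra hc
    obtain ⟨k, hk⟩ := (hcoef 0).exists
    rw [not_and_or, Finset.not_nonempty_iff_eq_empty, Finset.not_nonempty_iff_eq_empty] at hc
    rcases hc with hc | hc <;> simp [hc] at hk
  have c1 := hne.1.card_pos
  have c2 := hne.2.card_pos
  have ct : t.support.card = 1 := by nlinarith
  have cs : s.support.card = 1 := by nlinarith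
  obtain ⟨j0, hj0⟩ := Finset.card_eq_one.mp ct
  obtain ⟨i0, hi0⟩ := Finset.card_eq_one.mp cs
  have hu : UniqueAdd t.support s.support j0 i0 := by
    rw [hj0, hi0]
    intro a b ha hb _
    exact ⟨Finset.mem_singleton.mp ha, Finset.mem_singleton.mp hb⟩
  obtain ⟨hk, h0⟩ := huniq j0 (by simp [hj0]) i0 (by simp [hi0]) hu
  have hp : t j0 * (s i0).comp (Polynomial.X + Polynomial.C (j0 : K)) = 1 := by
    apply poly_ev
    filter_upwards [hk] with k hk
    rw [if_pos h0] at hk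
    simp only [Polynomial.eval_mul, Polynomial.eval_comp, Polynomial.eval_add, Polynomial.eval_X,
      Polynomial.eval_C, Polynomial.eval_one]
    rw [hk]; simp
  have hunit : IsUnit ((s i0).comp (Polynomial.X + Polynomial.C (j0 : K))) :=
    IsUnit.of_mul_eq_one_right _ hp
  have hdeg := Polynomial.natDegree_eq_zero_of_isUnit hunit
  rw [Polynomial.natDegree_comp, Polynomial.natDegree_X_add_C, mul_one] at hdeg
  obtain ⟨l, hl⟩ := Polynomial.natDegree_eq_zero.mp hdeg
  have hsupp : s = Finsupp.single i0 (s i0) := by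
    rw [← Finsupp.support_subset_singleton, hi0]
  refine ⟨-i0, l, ?_, ?_⟩
  · rintro rfl
    have : s i0 ≠ 0 := by rw [← Finsupp.mem_support_iff, hi0]; simp
    exact this (by rw [← hl]; simp)
  · rw [neg_neg, hl, ← hsupp]; exact hs

/-- The symbol of `H` when `[D, H] = D`. -/
lemma Hsym {D H : Module.End K (Polynomial K)} {r : ℤ} {l : K} (hl : l ≠ 0)
    (hD : HasSym D (Finsupp.single (-r) (Polynomial.C l))) {s : ℤ →₀ Polynomial K}
    (hH : HasSym H s) (h : D * H - H * D = D) :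
    r ≠ 0 ∧ ∃ c : K, s 0 = Polynomial.C ((r : K)⁻¹) * Polynomial.X + Polynomial.C c := by
  classical
  have hp : s 0 - (s 0).comp (Polynomial.X + Polynomial.C (-r : K)) = 1 := by
    apply poly_ev
    have h1 : ∀ᶠ k : ℤ in atTop, ∀ j ∈ s.support, D (u K (k + j)) = l • u K (k + j - r) := by
      rw [Filter.eventually_all_finset]
      intro j _
      filter_upwards [ev_shift hD j] with k hk
      rw [hk, act_single]; simp [sub_eq_add_neg]
    filter_upwards [h1, hH, hD, ev_shift hH (-r), eventually_ge_atTop r] with k h1 h2 h3 h4 h5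
    have e := congrArg (fun f => cu K (k + -r) (f (u K k))) h
    simp only [LinearMap.sub_apply, Module.End.mul_apply] at e
    have f1 : D (H (u K k)) = l • ∑ j ∈ s.support, (s j).eval (k : K) • u K (k + j - r) := by
      rw [h2, act, Finsupp.sum, map_sum, Finset.smul_sum]
      refine Finset.sum_congr rfl fun j hj => ?_
      rw [map_smul, h1 j hj, smul_comm]
    have f2 : cu K (k + -r) (∑ j ∈ s.support, (s j).eval (k : K) • u K (k + j - r)) =
        (s 0).eval (k : K) := by
      rw [map_sum]
      have e : ∀ j, (k + j - r = k + -r) ↔ j = 0 := by intro j; omega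
      simp only [map_smul, cu_u (show 0 ≤ k + -r by omega), e, smul_eq_mul, mul_ite, mul_one,
        mul_zero]
      rw [Finset.sum_ite_eq']
      split_ifs with h
      · rfl
      · simp [Finsupp.notMem_support_iff.mp h]
    have f3 := cu_act (s := s) (k := k + -r) (i := 0) (by omega)
    rw [add_zero] at f3
    rw [f1, h3, act_single, Polynomial.eval_C, map_sub, map_smul, map_smul, map_smul, map_smul, f2,
      h4, f3, cu_u (by omega), if_pos rfl] at e
    simp only [smul_eq_mul] at e
    rw [← mul_sub] at e
    have := mul_left_cancel₀ hl e
    simp only [Polynomial.eval_sub, Polynomial.eval_comp, Polynomial.eval_add, Polynomial.eval_X,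
      Polynomial.eval_C, Polynomial.eval_one]
    push_cast at this
    exact this
  have hr : r ≠ 0 := by
    rintro rfl
    simp at hp
  have hrK : (r : K) ≠ 0 := by exact_mod_cast hr
  refine ⟨hr, ?_⟩
  set q := s 0 - Polynomial.C ((r : K)⁻¹) * Polynomial.X with hq
  have hstep : ∀ x : K, q.eval (x - r) = q.eval x := by
    intro x
    have := congrArg (Polynomial.eval x) hp
    simp only [Polynomial.eval_sub, Polynomial.eval_comp, Polynomial.eval_add, Polynomial.eval_X,
      Polynomial.eval_C, Polynomial.eval_one, ← sub_eq_add_neg] at this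
    simp only [hq, Polynomial.eval_sub, Polynomial.eval_mul, Polynomial.eval_X, Polynomial.eval_C]
    have e : (r : K)⁻¹ * (x - r) = (r : K)⁻¹ * x - 1 := by field_simp
    rw [e]
    linear_combination -this
  have hall : ∀ n : ℕ, q.eval (-(n * r : K)) = q.eval 0 := by
    intro n
    induction n with
    | zero => simp
    | succ n ih =>
      rw [← ih, ← hstep (-(n * r : K))]
      congr 1; push_cast; ring
  refine ⟨q.eval 0, ?_⟩
  have : q - Polynomial.C (q.eval 0) = 0 := by
    apply Polynomial.eq_zero_of_infinite_isRoot
    refine (Set.infinite_range_of_injective (f := fun n : ℕ => -(n * r : K)) ?_).mono ?_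
    · intro a b hab
      simp only [neg_inj] at hab
      exact_mod_cast mul_right_cancel₀ hrK hab
    · rintro _ ⟨n, rfl⟩
      simp [Polynomial.IsRoot, hall n]
  linear_combination (exp := 1) this + hq

/-- Polynomials of degree `< k`. -/
def PZ (K : Type*) [Field K] (k : ℤ) : Submodule K (Polynomial K) := Polynomial.degreeLT K k.toNat

lemma mem_PZ {k : ℤ} {p : Polynomial K} : p ∈ PZ K k ↔ ∀ n : ℕ, k ≤ n → p.coeff n = 0 := by
  rw [PZ, Polynomial.mem_degreeLT, Polynomial.degree_lt_iff_coeff_zero]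
  simp

lemma PZ_mono {k m : ℤ} (h : k ≤ m) : PZ K k ≤ PZ K m :=
  Polynomial.degreeLT_mono (by omega)

lemma u_mem {j k : ℤ} (h : j < k) : u K j ∈ PZ K k := by
  rw [mem_PZ]
  intro n hn
  rcases lt_or_ge j 0 with hj | hj
  · simp [u_neg hj]
  · obtain ⟨j, rfl⟩ := Int.eq_ofNat_of_zero_le hj
    rw [u_nat, Polynomial.coeff_monomial, if_neg (by omega)]

lemma exists_PZ (p : Polynomial K) : ∃ k : ℕ, p ∈ PZ K k := by
  refine ⟨p.natDegree + 1, ?_⟩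
  rw [mem_PZ]
  intro n hn
  exact Polynomial.coeff_eq_zero_of_natDegree_lt (by omega)

lemma PZ_zero {k : ℤ} (hk : k ≤ 0) {p : Polynomial K} (hp : p ∈ PZ K k) : p = 0 := by
  rw [mem_PZ] at hp
  ext n
  rw [hp n (by omega)]; simp

lemma decomp {k : ℤ} (hk : 0 ≤ k) {p : Polynomial K} (hp : p ∈ PZ K (k + 1)) :
    ∃ c : K, ∃ q ∈ PZ K k, p = c • u K k + q := by
  obtain ⟨k, rfl⟩ := Int.eq_ofNat_of_zero_le hk
  have h2 : (k.factorial : K) ≠ 0 := by exact_mod_cast Nat.factorial_ne_zero k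
  refine ⟨p.coeff k * k.factorial, p - (p.coeff k * k.factorial) • u K k, ?_, by abel⟩
  rw [mem_PZ] at hp ⊢
  intro n hn
  rw [u_nat, Polynomial.smul_monomial, smul_eq_mul, mul_assoc, mul_inv_cancel₀ h2, mul_one,
    Polynomial.coeff_sub, Polynomial.coeff_monomial]
  by_cases e : k = n
  · subst e; simp
  · rw [if_neg e, hp n (by omega)]; simp

lemma u_notMem {k : ℤ} (hk : 0 ≤ k) : u K k ∉ PZ K k := by
  intro h
  obtain ⟨k, rfl⟩ := Int.eq_ofNat_of_zero_le hk
  rw [mem_PZ] at h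
  have := h k le_rfl
  rw [u_nat, Polynomial.coeff_monomial, if_pos rfl] at this
  have h2 : (k.factorial : K) ≠ 0 := by exact_mod_cast Nat.factorial_ne_zero k
  exact inv_ne_zero h2 this

instance (k : ℤ) : FiniteDimensional K (PZ K k) :=
  Module.Finite.equiv (Polynomial.degreeLTEquiv K k.toNat).symm

lemma finrank_PZ (k : ℤ) : Module.finrank K (PZ K k) = k.toNat := by
  have := (Polynomial.degreeLTEquiv K k.toNat).finrank_eq
  rw [Module.finrank_fin_fun] at this
  exact this

lemma exists_bound (a : Module.End K (Polynomial K)) (d : ℕ) :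
    ∃ e : ℤ, ∀ p ∈ PZ K d, a p ∈ PZ K e := by
  induction d with
  | zero =>
    refine ⟨0, fun p hp => ?_⟩
    rw [PZ_zero (by simp) hp, map_zero]; exact zero_mem _
  | succ d ih =>
    obtain ⟨e, he⟩ := ih
    obtain ⟨f, hf⟩ := exists_PZ (a (u K d))
    refine ⟨max e f, fun p hp => ?_⟩
    obtain ⟨c, q, hq, rfl⟩ := decomp (k := d) (by positivity) (by simpa using hp)
    rw [map_add, map_smul]
    exact add_mem (Submodule.smul_mem _ _ (PZ_mono (le_max_right _ _) hf))
      (PZ_mono (le_max_left _ _) (he q hq))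

lemma top_lemma {a : Module.End K (Polynomial K)} {s : ℤ →₀ Polynomial K} {N : ℤ}
    (hs : HasSym a s) (hN : ∀ i ∈ s.support, i ≤ N) :
    ∀ᶠ k : ℤ in atTop, (∀ p ∈ PZ K k, a p ∈ PZ K (k + N)) ∧
      a (u K k) - (s N).eval (k : K) • u K (k + N) ∈ PZ K (k + N) := by
  classical
  have hlead : ∀ᶠ k : ℤ in atTop, a (u K k) - (s N).eval (k : K) • u K (k + N) ∈ PZ K (k + N) := by
    filter_upwards [hs] with k hk
    have : act s k - (s N).eval (k : K) • u K (k + N) =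
        ∑ i ∈ s.support.erase N, (s i).eval (k : K) • u K (k + i) := by
      rw [act, Finsupp.sum]
      by_cases h : N ∈ s.support
      · rw [← Finset.add_sum_erase _ _ h]; abel
      · rw [Finset.erase_eq_of_notMem h, Finsupp.notMem_support_iff.mp h]; simp
    rw [hk, this]
    refine Submodule.sum_mem _ fun i hi => Submodule.smul_mem _ _ (u_mem ?_)
    have h1 := hN i (Finset.mem_of_mem_erase hi)
    have h2 := Finset.ne_of_mem_erase hi
    omega
  obtain ⟨d, hd⟩ := eventually_atTop.mp hlead
  obtain ⟨e, he⟩ := exists_bound a d.toNat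
  have key : ∀ j : ℕ, ∀ p ∈ PZ K (d.toNat + j), a p ∈ PZ K (max e (d.toNat + j + N)) := by
    intro j
    induction j with
    | zero => intro p hp; exact PZ_mono (le_max_left _ _) (he p (by simpa using hp))
    | succ j ih =>
      intro p hp
      obtain ⟨c, q, hq, rfl⟩ := decomp (k := d.toNat + j) (by positivity)
        (by simpa [add_assoc] using hp)
      rw [map_add, map_smul]
      refine add_mem (Submodule.smul_mem _ _ ?_) (PZ_mono ?_ (ih q hq))
      · have h1 := hd (d.toNat + j) (by omega)
        have h2 : a (u K (d.toNat + j)) = (a (u K (d.toNat + j)) - (s N).eval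
          ((d.toNat + j : ℤ) : K) • u K (d.toNat + j + N)) + (s N).eval
          ((d.toNat + j : ℤ) : K) • u K (d.toNat + j + N) := by abel
        rw [h2]
        refine add_mem (PZ_mono ?_ h1) (Submodule.smul_mem _ _ (u_mem ?_))
        · push_cast; omega
        · push_cast; omega
      · push_cast; omega
  filter_upwards [hlead, eventually_ge_atTop (d.toNat : ℤ), eventually_ge_atTop (e - N)] with k h1 h2 h3
  refine ⟨fun p hp => ?_, h1⟩
  have := key (k - d.toNat).toNat p (PZ_mono (by omega) hp)
  exact PZ_mono (by omega) this

lemma top_inj {a : Module.End K (Polynomial K)} {s : ℤ →₀ Polynomial K} {N : ℤ}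
    (hs : HasSym a s) (hN : ∀ i ∈ s.support, i ≤ N) (h0 : s N ≠ 0) :
    ∀ᶠ k : ℤ in atTop, ∀ p ∈ PZ K (k + 1), a p ∈ PZ K (k + N) → p ∈ PZ K k := by
  filter_upwards [top_lemma hs hN, poly_ne h0, eventually_ge_atTop 0, eventually_ge_atTop (-N)]
    with k hk hne h1 h2 p hp hap
  obtain ⟨c, q, hq, rfl⟩ := decomp h1 hp
  by_cases hc : c = 0
  · subst hc; simpa using hq
  exfalso
  apply u_notMem (K := K) (k := k + N) (by omega)
  rw [map_add, map_smul] at hap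
  have h3 : a (u K k) ∈ PZ K (k + N) := by
    have := (Submodule.add_mem_iff_left _ (hk.1 q hq)).mp hap
    exact (Submodule.smul_mem_iff _ hc).mp this
  have h4 := sub_mem h3 hk.2
  rw [sub_sub_cancel] at h4
  exact (Submodule.smul_mem_iff _ hne).mp h4

lemma trace_lemma {D X : Module.End K (Polynomial K)} (W P : Submodule K (Polynomial K))
    [FiniteDimensional K P] (hD : W ≤ W.comap D) (hX : W ≤ W.comap X) (hWP : W ⊔ P = ⊤)
    (h : D * X - X * D = 1) : W = ⊤ := by
  have hs : Function.Surjective (W.mkQ ∘ₗ P.subtype) := by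
    intro y
    obtain ⟨p, rfl⟩ := W.mkQ_surjective y
    have hp : p ∈ W ⊔ P := by rw [hWP]; trivial
    obtain ⟨w, hw, q, hq, rfl⟩ := Submodule.mem_sup.mp hp
    refine ⟨⟨q, hq⟩, ?_⟩
    simp [hw]
  have : FiniteDimensional K (Polynomial K ⧸ W) := Module.Finite.of_surjective _ hs
  have e : (W.mapQ W D hD) * (W.mapQ W X hX) - (W.mapQ W X hX) * (W.mapQ W D hD) = 1 := by
    apply Submodule.linearMap_qext
    refine LinearMap.ext fun p => ?_
    have := congrArg (fun f => W.mkQ (f p)) h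
    simpa using this
  have t := congrArg (LinearMap.trace K _) e
  rw [map_sub, LinearMap.trace_mul_comm, sub_self, LinearMap.trace_one] at t
  have t' : Module.finrank K (Polynomial K ⧸ W) = 0 := by exact_mod_cast t.symm
  have := Module.finrank_zero_iff.mp t'
  exact Submodule.Quotient.subsingleton_iff.mp this

lemma one_dim {V : Type*} [AddCommGroup V] [Module K V] (L : Submodule K V)
    (h : Module.finrank K L = 1) : ∃ v ∈ L, v ≠ 0 ∧ ∀ w ∈ L, ∃ c : K, w = c • v := by
  obtain ⟨v, hv0, hv⟩ := finrank_eq_one_iff'.mp h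
  refine ⟨v, v.2, by simpa using hv0, fun w hw => ?_⟩
  obtain ⟨c, hc⟩ := hv ⟨w, hw⟩
  exact ⟨c, (congrArg Subtype.val hc).symm⟩

lemma sup_lemma {D : Module.End K (Polynomial K)} (P : Submodule K (Polynomial K))
    [FiniteDimensional K P] (hP : ∀ p ∈ P, D p ∈ P) (h : ∀ p, ∃ i : ℕ, (D ^ i) p ∈ P)
    (p : Polynomial K) : ∃ q ∈ P, ∃ i : ℕ, (D ^ i) (p - q) = 0 := by
  have hpow : ∀ (n : ℕ) (x : P), (((D.restrict hP) ^ n) x : Polynomial K) = (D ^ n) x := by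
    intro n
    induction n with
    | zero => intro x; simp
    | succ n ih => intro x; rw [pow_succ, pow_succ, Module.End.mul_apply, Module.End.mul_apply, ih]; rfl
  obtain ⟨n, hn⟩ := IsArtinian.monotone_stabilizes (LinearMap.iterateRange (D.restrict hP))
  obtain ⟨i, hi⟩ := h p
  have h1 : ((D.restrict hP) ^ n) ⟨_, hi⟩ ∈ LinearMap.range ((D.restrict hP) ^ n) := ⟨_, rfl⟩
  have h2 : LinearMap.range ((D.restrict hP) ^ n) = LinearMap.range ((D.restrict hP) ^ (n + i)) :=
    hn (n + i) (by omega)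
  rw [h2] at h1
  obtain ⟨q, hq⟩ := h1
  refine ⟨q, q.2, n + i, ?_⟩
  have := congrArg Subtype.val hq
  rw [hpow, hpow] at this
  rw [map_sub, this, pow_add, Module.End.mul_apply, sub_self]

lemma loc_nilp {D X : Module.End K (Polynomial K)} (h : D * X - X * D = 1) {d : ℤ}
    (hd : ∀ k ≥ d, ∀ p ∈ PZ K k, D p ∈ PZ K (k - 1)) (p : Polynomial K) :
    ∃ i : ℕ, (D ^ i) p = 0 := by
  have hc : ∀ p, D (X p) = X (D p) + p := by
    intro p
    have := congrArg (fun f => f p) h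
    simp only [LinearMap.sub_apply, Module.End.mul_apply, Module.End.one_apply] at this
    rw [sub_eq_iff_eq_add] at this
    rw [this]; abel
  let W : Submodule K (Polynomial K) :=
    { carrier := {p | ∃ i : ℕ, (D ^ i) p = 0}
      zero_mem' := ⟨0, by simp⟩
      add_mem' := by
        rintro a b ⟨i, hi⟩ ⟨j, hj⟩
        refine ⟨i + j, ?_⟩
        rw [map_add, pow_add, Module.End.mul_apply, Module.End.mul_apply, hj, map_zero, add_zero,
          ← Module.End.mul_apply, ← pow_add, add_comm, pow_add, Module.End.mul_apply, hi, map_zero]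
      smul_mem' := by
        rintro c a ⟨i, hi⟩
        exact ⟨i, by rw [map_smul, hi, smul_zero]⟩ }
  have hW : W = ⊤ := by
    apply trace_lemma W (PZ K d) (D := D) (X := X) _ _ _ h
    · rintro p ⟨i, hi⟩
      refine ⟨i, ?_⟩
      rw [← Module.End.mul_apply, ← pow_succ, pow_succ', Module.End.mul_apply, hi, map_zero]
    · have key : ∀ (i : ℕ) (p : Polynomial K), (D ^ i) p = 0 → (D ^ (i + 1)) (X p) = 0 := by
        intro i
        induction i with
        | zero => intro p hp; simp at hp; simp [hp]
        | succ i ih =>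
          intro p hp
          rw [pow_succ, Module.End.mul_apply, hc, map_add, hp, add_zero]
          apply ih
          rwa [← Module.End.mul_apply, ← pow_succ]
      rintro p ⟨i, hi⟩
      exact ⟨i + 1, key i p hi⟩
    · rw [eq_top_iff]
      intro p _
      have hex : ∀ p, ∃ i : ℕ, (D ^ i) p ∈ PZ K d := by
        have : ∀ (j : ℕ) (p), p ∈ PZ K (d + j) → (D ^ j) p ∈ PZ K d := by
          intro j
          induction j with
          | zero => intro p hp; simpa using hp
          | succ j ih =>
            intro p hp
            rw [pow_succ, Module.End.mul_apply]
            apply ih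
            exact PZ_mono (by push_cast; omega) (hd (d + (j + 1 : ℕ)) (by omega) p hp)
        intro p
        obtain ⟨k, hk⟩ := exists_PZ p
        exact ⟨(k - d).toNat, this _ p (PZ_mono (by omega) hk)⟩
      obtain ⟨q, hq, i, hi⟩ := sup_lemma (D := D) (PZ K d)
        (fun p hp => PZ_mono (by omega) (hd d le_rfl p hp)) hex p
      have : p = (p - q) + q := by abel
      rw [this]
      exact Submodule.add_mem_sup ⟨i, hi⟩ hq
  have : p ∈ W := by rw [hW]; trivial
  exact this

lemma main {D J X : Module.End K (Polynomial K)} (mD : D ∈ I1 K) (mJ : J ∈ I1 K) (mX : X ∈ I1 K)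
    (hDJ : D * J = 1) (hDX : D * X - X * D = 1) (hXJ : X = J * (D * X)) :
    (∀ p, ∃ i : ℕ, (D ^ i) p = 0) ∧ ∃ v, v ≠ 0 ∧ D v = 0 ∧ ∀ w, D w = 0 → ∃ c : K, w = c • v := by
  obtain ⟨H, hH⟩ : ∃ H, H = D * X := ⟨_, rfl⟩
  have mH : H ∈ I1 K := by rw [hH]; exact mul_mem mD mX
  have hDH : D * H - H * D = D := by
    rw [hH, mul_assoc, ← mul_sub, hDX, mul_one]
  have hH' : H = X * D + 1 := by rw [hH, ← hDX]; abel
  have hHJ : H * J = J * H + J := by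
    rw [← hH] at hXJ
    rw [← hXJ, hH', add_mul, mul_assoc, hDJ]; simp
  have aDJ : ∀ p, D (J p) = p := fun p => by
    rw [← Module.End.mul_apply, hDJ]; rfl
  have aHJ : ∀ p, H (J p) = J (H p) + J p := fun p => by
    rw [← Module.End.mul_apply, hHJ]; rfl
  have aH : ∀ p, D p = 0 → H p = p := fun p hp => by
    rw [hH']; simp [hp]
  have aHD : ∀ p, H (D p) = D (H p) - D p := fun p => by
    have := congrArg (fun f => f p) hDH
    simp only [LinearMap.sub_apply, Module.End.mul_apply] at this
    rw [sub_eq_iff_eq_add] at this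
    rw [this]; abel
  obtain ⟨r, l, hl, sD⟩ := homog mD mJ hDJ
  obtain ⟨s, sH⟩ := exists_sym mH
  obtain ⟨hr, c, hs0⟩ := Hsym hl sD sH hDH
  have hrK : (r : K) ≠ 0 := by exact_mod_cast hr
  have supD : ∀ i ∈ (Finsupp.single (-r) (Polynomial.C l)).support, i ≤ -r := by
    intro i hi
    exact (Finset.mem_singleton.mp (Finsupp.support_single_subset hi)).le
  obtain ⟨d, hd⟩ := eventually_atTop.mp ((top_lemma sD supD).and ((top_inj sD supD
    (by simpa using hl)).and ((eventually_ge_atTop 0).and (eventually_ge_atTop (|r|)))))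
  have hpre : ∀ k ≥ d, ∀ p, D p ∈ PZ K (k - r) → p ∈ PZ K k := by
    intro k hk p hp
    have : ∀ j : ℕ, p ∈ PZ K (k + j) → p ∈ PZ K k := by
      intro j
      induction j with
      | zero => simp
      | succ j ih =>
        intro hj
        apply ih
        apply (hd (k + j) (by omega)).2.1 p
        · exact PZ_mono (by push_cast; omega) hj
        · exact PZ_mono (by omega) hp
    obtain ⟨m, hm⟩ := exists_PZ p
    exact this (m - k).toNat (PZ_mono (by omega) hm)
  have hJP : ∀ k ≥ d, ∀ p ∈ PZ K (k - r), J p ∈ PZ K k := by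
    intro k hk p hp
    apply hpre k hk
    rwa [aDJ]
  have hd0 := (hd d le_rfl).2.2.1
  have hdr := (hd d le_rfl).2.2.2
  have hrle := le_abs_self r
  have hrpos : 0 < r := by
    have hinj : Function.Injective (J.restrict (hJP d le_rfl)) := by
      intro x y hxy
      have := congrArg (fun z : PZ K d => D z) hxy
      simp only [LinearMap.restrict_apply, aDJ] at this
      exact Subtype.ext this
    have := LinearMap.finrank_le_finrank_of_injective hinj
    rw [finrank_PZ, finrank_PZ] at this
    omega
  have hnil : ∀ p, ∃ i : ℕ, (D ^ i) p = 0 := by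
    apply loc_nilp hDX (d := d)
    intro k hk p hp
    exact PZ_mono (by omega) ((hd k hk).1.1 p hp)
  refine ⟨hnil, ?_⟩
  -- eigenvalues of `H` are positive integers
  have heig : ∀ (m : K) (p : Polynomial K), p ≠ 0 → H p = m • p → ∃ i : ℕ, m = i := by
    have : ∀ (i : ℕ) (m : K) (p : Polynomial K), p ≠ 0 → (D ^ i) p = 0 → H p = m • p →
        ∃ i : ℕ, m = i := by
      intro i
      induction i with
      | zero => intro m p h0 h1; exact absurd (by simpa using h1) h0
      | succ i ih =>
        intro m p h0 h1 h2
        by_cases hDp : D p = 0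
        · refine ⟨1, ?_⟩
          have h3 := aH p hDp
          rw [h2] at h3
          have h4 : (m - 1) • p = 0 := by rw [sub_smul, h3, one_smul, sub_self]
          rcases smul_eq_zero.mp h4 with h5 | h5
          · rw [sub_eq_zero.mp h5]; simp
          · exact absurd h5 h0
        · obtain ⟨j, hj⟩ := ih (m - 1) (D p) hDp
            (by rwa [← Module.End.mul_apply, ← pow_succ])
            (by rw [aHD, h2, map_smul, sub_smul, one_smul])
          exact ⟨j + 1, by push_cast; rw [← hj]; ring⟩
    intro m p h0 h1
    obtain ⟨i, hi⟩ := hnil p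
    exact this i m p h0 hi h1
  -- the eigenvectors of `H` span
  have hspan : Submodule.span K {p | ∃ m : K, H p = m • p} = ⊤ := by
    set E := Submodule.span K {p | ∃ m : K, H p = m • p} with hE
    have hJE : ∀ p ∈ E, J p ∈ E := by
      intro p hp
      have : E ≤ E.comap J := by
        rw [hE, Submodule.span_le]
        rintro p ⟨m, hm⟩
        refine Submodule.subset_span ⟨m + 1, ?_⟩
        rw [aHJ, hm, map_smul, add_smul, one_smul]
      exact this hp
    have : ∀ (i : ℕ) (p : Polynomial K), (D ^ i) p = 0 → p ∈ E := by
      intro i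
      induction i with
      | zero => intro p hp; have : p = 0 := by simpa using hp
                rw [this]; exact zero_mem _
      | succ i ih =>
        intro p hp
        have h1 := ih (D p) (by rwa [← Module.End.mul_apply, ← pow_succ])
        have h2 : p = J (D p) + (p - J (D p)) := by abel
        rw [h2]
        refine add_mem (hJE _ h1) (Submodule.subset_span ⟨1, ?_⟩)
        rw [one_smul]
        apply aH
        rw [map_sub, aDJ, sub_self]
    rw [eq_top_iff]
    intro p _
    obtain ⟨i, hi⟩ := hnil p
    exact this i p hi
  have hs00 : s 0 ≠ 0 := by
    intro h
    rw [h] at hs0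
    have := congrArg (fun p => Polynomial.coeff p 1) hs0
    simp [Polynomial.coeff_C] at this
    exact hrK this.symm
  have hmem0 : (0 : ℤ) ∈ s.support := Finsupp.mem_support_iff.mpr hs00
  obtain ⟨N, hN⟩ : ∃ N, N = s.support.max' ⟨0, hmem0⟩ := ⟨_, rfl⟩
  have hNmem : N ∈ s.support := hN ▸ Finset.max'_mem _ _
  have supH : ∀ i ∈ s.support, i ≤ N := fun i hi => hN ▸ Finset.le_max' _ _ hi
  have hN0 : N = 0 := by
    by_contra hne
    have hNpos : 1 ≤ N := by have := supH 0 hmem0; omega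
    obtain ⟨e, he⟩ := eventually_atTop.mp ((top_inj sH supH (Finsupp.mem_support_iff.mp hNmem)))
    have hle : Submodule.span K {p | ∃ m : K, H p = m • p} ≤ PZ K e := by
      rw [Submodule.span_le]
      rintro p ⟨m, hm⟩
      have : ∀ j : ℕ, p ∈ PZ K (e + j) → p ∈ PZ K e := by
        intro j
        induction j with
        | zero => simp
        | succ j ih =>
          intro hj
          apply ih
          have hj' : p ∈ PZ K (e + j + 1) := PZ_mono (by push_cast; omega) hj
          apply he (e + j) (by omega) p hj'
          rw [hm]
          exact Submodule.smul_mem _ _ (PZ_mono (by omega) hj')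
      obtain ⟨k, hk⟩ := exists_PZ p
      exact this (k - e).toNat (PZ_mono (by omega) hk)
    rw [hspan] at hle
    have h1 : u K (max e 0) ∈ PZ K e := hle trivial
    exact u_notMem (le_max_right _ _) (PZ_mono (le_max_left _ _) h1)
  subst hN0
  obtain ⟨e, he⟩ := eventually_atTop.mp ((top_lemma sH supH).and (eventually_ge_atTop 0))
  have hval : ∀ k ≥ e, ∃ i : ℕ, (s 0).eval (k : K) = i := by
    intro k hk
    obtain ⟨⟨h1, h2⟩, h3⟩ := he k hk
    rw [add_zero] at h1 h2
    obtain ⟨m, hm⟩ : ∃ m, m = (s 0).eval (k : K) := ⟨_, rfl⟩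
    rw [← hm] at h2 ⊢
    have hmap : ∀ p ∈ PZ K (k + 1), (H - m • (1 : Module.End K (Polynomial K))) p ∈ PZ K k := by
      intro p hp
      obtain ⟨c, q, hq, rfl⟩ := decomp h3 hp
      rw [map_add, map_smul]
      refine add_mem (Submodule.smul_mem _ _ ?_) ?_
      · simpa using h2
      · simpa using sub_mem (h1 q hq) (Submodule.smul_mem _ m hq)
    have hni : ¬ Function.Injective
        ((H - m • (1 : Module.End K (Polynomial K))).restrict hmap) := by
      intro hinj
      have := LinearMap.finrank_le_finrank_of_injective hinj
      rw [finrank_PZ, finrank_PZ] at this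
      omega
    rw [injective_iff_map_eq_zero] at hni
    push Not at hni
    obtain ⟨p, hp, hp0⟩ := hni
    have hp' := congrArg Subtype.val hp
    simp only [LinearMap.restrict_apply, LinearMap.sub_apply, LinearMap.smul_apply,
      Module.End.one_apply, ZeroMemClass.coe_zero] at hp'
    exact heig m p (by simpa using hp0) (sub_eq_zero.mp hp')
  have hr1 : r = 1 := by
    obtain ⟨i, hi⟩ := hval e le_rfl
    obtain ⟨j, hj⟩ := hval (e + 1) (by omega)
    rw [hs0] at hi hj
    simp only [Polynomial.eval_add, Polynomial.eval_mul, Polynomial.eval_C, Polynomial.eval_X]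
      at hi hj
    have h1 : (r : K)⁻¹ = ((j - i : ℤ) : K) := by
      push_cast at hj ⊢
      rw [← hi, ← hj]; ring
    have h2 : ((r * (j - i) : ℤ) : K) = 1 := by
      rw [Int.cast_mul, ← h1, mul_inv_cancel₀ hrK]
    have h3 : r * (j - i) = 1 := by exact_mod_cast h2
    exact Int.eq_one_of_mul_eq_one_right hrpos.le h3
  subst hr1
  -- kernel is one dimensional
  obtain ⟨f, hf⟩ : ∃ f, f = D.restrict (hd d le_rfl).1.1 := ⟨_, rfl⟩
  have hsurj : Function.Surjective f := by
    intro y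
    refine ⟨⟨J y, hJP d le_rfl y ?_⟩, ?_⟩
    · exact y.2
    · rw [hf]; apply Subtype.ext
      exact aDJ _
  have hk := LinearMap.finrank_range_add_finrank_ker f
  rw [LinearMap.range_eq_top.mpr hsurj, finrank_top, finrank_PZ, finrank_PZ] at hk
  have hk1 : Module.finrank K (LinearMap.ker f) = 1 := by
    rw [abs_one] at hdr; omega
  obtain ⟨v, hvm, hv0, hv⟩ := one_dim (LinearMap.ker f) hk1
  have hfD : ∀ x : PZ K d, (f x : Polynomial K) = D x := by intro x; rw [hf]; rfl
  refine ⟨v, ?_, ?_, ?_⟩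
  · simpa using hv0
  · rw [LinearMap.mem_ker] at hvm
    rw [← hfD, hvm]; rfl
  · intro w hw
    have hwP : w ∈ PZ K d := hpre d le_rfl w (by rw [hw]; exact zero_mem _)
    obtain ⟨c, hc⟩ := hv ⟨w, hwP⟩ (by
      rw [LinearMap.mem_ker]; apply Subtype.ext; rw [hfD]; exact hw)
    exact ⟨c, by have := congrArg (fun z => ((z : PZ K d) : Polynomial K)) hc; exact this⟩

lemma exists_iso {D J X : Module.End K (Polynomial K)}
    (hDJ : D * J = 1) (hDX : D * X - X * D = 1) (hXJ : X = J * (D * X))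
    (hnil : ∀ p, ∃ i : ℕ, (D ^ i) p = 0) {v : Polynomial K} (hv : v ≠ 0) (hDv : D v = 0)
    (hker : ∀ w, D w = 0 → ∃ c : K, w = c • v) :
    ∃ S : Polynomial K ≃ₗ[K] Polynomial K, (∀ p, S (derOp K p) = D (S p)) ∧
      (∀ p, S (intOp K p) = J (S p)) ∧ (∀ p, S (xOp K p) = X (S p)) := by
  have aDJ : ∀ p, D (J p) = p := fun p => by
    rw [← Module.End.mul_apply, hDJ]; rfl
  have hX : ∀ p, X (J p) = J (D (X (J p))) := fun p => by
    conv_lhs => rw [hXJ]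
    rfl
  have aDX : ∀ p, D (X p) = X (D p) + p := by
    intro p
    have := congrArg (fun f => f p) hDX
    simp only [LinearMap.sub_apply, Module.End.mul_apply, Module.End.one_apply] at this
    rw [sub_eq_iff_eq_add] at this
    rw [this]; abel
  let S : Polynomial K →ₗ[K] Polynomial K :=
    Polynomial.lsum fun n => LinearMap.toSpanSingleton K _ ((n.factorial : K) • (J ^ n) v)
  have hSu : ∀ n : ℕ, S (u K n) = (J ^ n) v := by
    intro n
    have h2 : (n.factorial : K) ≠ 0 := by exact_mod_cast Nat.factorial_ne_zero n
    simp only [S]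
    rw [u_nat, Polynomial.lsum_apply, Polynomial.sum_monomial_index _ _ (by simp)]
    simp [smul_smul, h2]
  have hS1 : S ∘ₗ derOp K = D ∘ₗ S := by
    apply ext_u
    intro n
    rw [LinearMap.comp_apply, LinearMap.comp_apply, der_u, hSu]
    rcases n with _ | n
    · rw [u_neg (by simp)]; simp [hDv]
    · have : ((n + 1 : ℕ) : ℤ) - 1 = (n : ℕ) := by simp
      rw [this, hSu, pow_succ', Module.End.mul_apply, aDJ]
  have hS2 : S ∘ₗ intOp K = J ∘ₗ S := by
    apply ext_u
    intro n
    have : ((n : ℕ) : ℤ) + 1 = (n + 1 : ℕ) := by simp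
    rw [LinearMap.comp_apply, LinearMap.comp_apply, int_u (by positivity), this, hSu, hSu, pow_succ',
      Module.End.mul_apply]
  have hXn : ∀ n : ℕ, X ((J ^ n) v) = ((n : K) + 1) • (J ^ (n + 1)) v := by
    intro n
    induction n with
    | zero =>
      have h1 : X v = J (D (X v)) := by
        conv_lhs => rw [hXJ]
        rfl
      have h2 : D (X v) = v := by rw [aDX, hDv]; simp
      rw [h2] at h1
      simpa using h1
    | succ n ih =>
      have h2 : D (X ((J ^ (n + 1)) v)) = ((n : K) + 1 + 1) • (J ^ (n + 1)) v := by
        rw [aDX]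
        have h3 : D ((J ^ (n + 1)) v) = (J ^ n) v := by
          rw [pow_succ' J n, Module.End.mul_apply, aDJ]
        rw [h3, ih]; module
      have h4 : X ((J ^ (n + 1)) v) = J (D (X ((J ^ (n + 1)) v))) := by
        rw [pow_succ' J n, Module.End.mul_apply]; exact hX _
      rw [h4, h2, map_smul, pow_succ' J (n + 1), Module.End.mul_apply]
      push_cast; rfl
  have hS3 : S ∘ₗ xOp K = X ∘ₗ S := by
    apply ext_u
    intro n
    have : ((n : ℕ) : ℤ) + 1 = (n + 1 : ℕ) := by simp
    rw [LinearMap.comp_apply, LinearMap.comp_apply, x_u (by positivity), this, map_smul, hSu, hSu,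
      hXn]
    simp
  have b1 : ∀ p, S (derOp K p) = D (S p) := fun p => LinearMap.congr_fun hS1 p
  have b2 : ∀ p, S (intOp K p) = J (S p) := fun p => LinearMap.congr_fun hS2 p
  have b3 : ∀ p, S (xOp K p) = X (S p) := fun p => LinearMap.congr_fun hS3 p
  have S1 : S 1 = v := by
    have := hSu 0
    rw [u_nat] at this
    simpa using this
  have hinj : Function.Injective S := by
    rw [injective_iff_map_eq_zero]
    have : ∀ (n : ℕ) (p : Polynomial K), p.natDegree ≤ n → S p = 0 → p = 0 := by
      intro n
      induction n with
      | zero =>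
        intro p hp hSp
        obtain ⟨a, rfl⟩ := Polynomial.natDegree_eq_zero.mp (Nat.le_zero.mp hp)
        rw [← mul_one (Polynomial.C a), ← Polynomial.smul_eq_C_mul, map_smul, S1] at hSp
        rcases smul_eq_zero.mp hSp with h | h
        · simp [h]
        · exact absurd h hv
      | succ n ih =>
        intro p hp hSp
        have h1 := ih (derOp K p) ((Polynomial.natDegree_derivative_le p).trans (by omega))
          (by rw [b1, hSp, map_zero])
        have h2 : p.natDegree = 0 := Polynomial.derivative_eq_zero.mp h1
        exact ih p (by omega) hSp
    intro p hp
    exact this _ p le_rfl hp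
  have hsurj : Function.Surjective S := by
    have : ∀ (i : ℕ) (p : Polynomial K), (D ^ i) p = 0 → ∃ q, S q = p := by
      intro i
      induction i with
      | zero => intro p hp; exact ⟨0, by rw [map_zero]; simpa using hp.symm⟩
      | succ i ih =>
        intro p hp
        obtain ⟨q, hq⟩ := ih (D p) (by rwa [← Module.End.mul_apply, ← pow_succ])
        obtain ⟨c, hc⟩ := hker (p - S (intOp K q)) (by rw [b2, map_sub, aDJ, hq, sub_self])
        refine ⟨c • 1 + intOp K q, ?_⟩
        rw [map_add, map_smul, S1, ← hc]; abel
    intro p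
    obtain ⟨i, hi⟩ := hnil p
    exact this i p hi
  exact ⟨LinearEquiv.ofBijective S ⟨hinj, hsurj⟩, b1, b2, b3⟩

end TW

end helpers

/-- For every `K`-algebra endomorphism `σ` of `I₁`, the `σ`-twisted
`I₁`-module `ᵟK[x]` (with action `a · p := σ(a)(p)`) is isomorphic as an `I₁`-module to
the natural `I₁`-module `K[x]` (with action `a · p := a(p)`). -/
theorem twisted_module_iso_natural (σ : I1 K →ₐ[K] I1 K) :
    ∃ T : Polynomial K ≃+ Polynomial K,
      ∀ (a : I1 K) (p : Polynomial K),
        T (((σ a : I1 K) : Module.End K (Polynomial K)) p) =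
          ((a : I1 K) : Module.End K (Polynomial K)) (T p) := by
  let XI : I1 K := ⟨xOp K, xOp_mem K⟩
  have e1 : DelI K * IntI K = 1 := Subtype.ext TW.der_int
  have e2 : DelI K * XI = 1 + XI * DelI K :=
    Subtype.ext (sub_eq_iff_eq_add.mp TW.weyl)
  have e3 : XI = IntI K * (DelI K * XI) := Subtype.ext TW.x_eq
  have f1 : (σ (DelI K) : Module.End K (Polynomial K)) * (σ (IntI K)) = 1 := by
    have := congrArg (fun z => ((σ z : I1 K) : Module.End K (Polynomial K))) e1
    simpa only [map_mul, map_one, MulMemClass.coe_mul, OneMemClass.coe_one] using this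
  have f2 : (σ (DelI K) : Module.End K (Polynomial K)) * (σ XI) - (σ XI) * (σ (DelI K)) = 1 := by
    have := congrArg (fun z => ((σ z : I1 K) : Module.End K (Polynomial K))) e2
    rw [sub_eq_iff_eq_add]
    simpa only [map_mul, map_one, map_add, MulMemClass.coe_mul, OneMemClass.coe_one,
      AddMemClass.coe_add] using this
  have f3 : (σ XI : Module.End K (Polynomial K)) = (σ (IntI K)) * ((σ (DelI K)) * (σ XI)) := by
    have := congrArg (fun z => ((σ z : I1 K) : Module.End K (Polynomial K))) e3
    simpa only [map_mul, MulMemClass.coe_mul] using this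
  obtain ⟨hnil, v, hv, hDv, hker⟩ := TW.main (σ (DelI K)).2 (σ (IntI K)).2 (σ XI).2 f1 f2 f3
  obtain ⟨S, b1, b2, b3⟩ := TW.exists_iso f1 f2 f3 hnil hv hDv hker
  have key : ∀ (a : Module.End K (Polynomial K)) (ha : a ∈ I1 K) (p : Polynomial K),
      S (a p) = ((σ ⟨a, ha⟩ : I1 K) : Module.End K (Polynomial K)) (S p) := by
    intro a ha
    induction ha using Algebra.adjoin_induction with
    | mem x hx =>
      rcases hx with rfl | rfl | rfl
      · exact b3
      · exact b1
      · exact b2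
    | algebraMap r =>
      intro p
      have : σ ⟨algebraMap K _ r, (I1 K).algebraMap_mem r⟩ = algebraMap K (I1 K) r :=
        σ.commutes r
      erw [this]
      simp
    | add a b ha hb iha ihb =>
      intro p
      have : σ ⟨a + b, add_mem ha hb⟩ = σ ⟨a, ha⟩ + σ ⟨b, hb⟩ := by rw [← map_add]; rfl
      erw [this]
      rw [LinearMap.add_apply, map_add, iha, ihb]; rfl
    | mul a b ha hb iha ihb =>
      intro p
      have : σ ⟨a * b, mul_mem ha hb⟩ = σ ⟨a, ha⟩ * σ ⟨b, hb⟩ := by rw [← map_mul]; rfl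
      erw [this]
      rw [Module.End.mul_apply, iha, ihb]; rfl
  refine ⟨S.symm.toAddEquiv, fun a p => ?_⟩
  show S.symm _ = (a : Module.End K (Polynomial K)) (S.symm p)
  rw [LinearEquiv.symm_apply_eq, key a.1 a.2, LinearEquiv.apply_symm_apply]

end
end
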